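/- For the Wright–Fisher diffusion with selection (parameters σ > 0 and s ≥ 0 fixed) and any bounded measurable group-level selection profile r⁰, there exists a critical value R_∧ > 0 such that for every 0 < R < R_∧, the killed system with r = R·r⁰ satisfies ρ_0 ∧ ρ_1 < ρ_α: when group selection is too weak, the quasi-stationary distribution on (0,1) decays strictly faster than at least one of the absorbing boundaries, so polymorphic groups cannot be maintained. -/

import Mathlib

open MeasureTheory ProbabilityTheory Filter Set
open scoped ENNReal NNReal Topology

noncomputable section

/-- The Wright–Fisher generator with selection `s` and diffusion parameter `σ`:
`𝓛_WF f(x) = -s x (1-x) f'(x) + (σ²/2) x (1-x) f''(x)`. -/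
def LWF (s σ : ℝ) (f : ℝ → ℝ) : ℝ → ℝ := fun x =>
  -s * x * (1 - x) * deriv f x + σ ^ 2 / 2 * (x * (1 - x)) * deriv (deriv f) x

/-- A (weak) solution of the Wright–Fisher SDE with selection
`dX_t = -s X_t (1-X_t) dt + σ √(X_t(1-X_t)) dB_t`, `X_0 ∼ μ₀`, characterized through
the associated martingale problem for the generator `LWF s σ`, enriched with an
independent standard exponential random variable `Tkill` used for the soft killing at
rate `-r ≥ 0`:  `τ_∂ = inf{t ≥ 0 : ∫₀ᵗ (-r(X_u)) du ≥ Tkill}`. -/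
structure WFKilled (s σ : ℝ) (r : ℝ → ℝ) (μ₀ : Measure ℝ) where
  (Ω : Type)
  [mΩ : MeasurableSpace Ω]
  (P : Measure Ω)
  (probP : IsProbabilityMeasure P)
  (X : ℝ → Ω → ℝ)
  (measX : ∀ t, Measurable (X t))
  (contX : ∀ ω, Continuous fun t => X t ω)
  (preZero : ∀ t ≤ (0:ℝ), X t = X 0)
  (range01 : ∀ t ω, X t ω ∈ Icc (0:ℝ) 1)
  (initLaw : P.map (X 0) = μ₀)
  (ℱ : Filtration ℝ mΩ)
  (adaptedX : Adapted ℱ X)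
  (martProblem : ∀ f : ℝ → ℝ, ContDiff ℝ 2 f →
    Martingale (fun t ω => f (X t ω) - ∫ u in Ioc (0:ℝ) t, LWF s σ f (X u ω)) ℱ P)
  (Tkill : Ω → ℝ)
  (measT : Measurable Tkill)
  (expLaw : ∀ t : ℝ, 0 ≤ t → P {ω | t < Tkill ω} = ENNReal.ofReal (Real.exp (-t)))
  (indepT : IndepFun (fun ω t => X t ω) Tkill P)

attribute [instance] WFKilled.mΩ WFKilled.probP

variable {s σ : ℝ} {r : ℝ → ℝ} {μ₀ : Measure ℝ}

/-- The survival event `{t < τ_∂}` for the soft killing at rate `-r`. -/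
def WFKilled.aliveSoft (W : WFKilled s σ r μ₀) (t : ℝ) : Set W.Ω :=
  {ω | ∫ u in Ioc (0:ℝ) t, (-(r (W.X u ω))) < W.Tkill ω}

/-- The event `{t < τ_0}`: the boundary point `0` has not been hit by time `t`. -/
def WFKilled.noHit0 (W : WFKilled s σ r μ₀) (t : ℝ) : Set W.Ω :=
  {ω | ∀ u ∈ Icc (0:ℝ) t, W.X u ω ≠ 0}

/-- The event `{t < τ_1}`: the boundary point `1` has not been hit by time `t`. -/
def WFKilled.noHit1 (W : WFKilled s σ r μ₀) (t : ℝ) : Set W.Ω :=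
  {ω | ∀ u ∈ Icc (0:ℝ) t, W.X u ω ≠ 1}

/-- The event `{t < τ_{0,1,∂}}`. -/
def WFKilled.aliveAll (W : WFKilled s σ r μ₀) (t : ℝ) : Set W.Ω :=
  W.aliveSoft t ∩ W.noHit0 t ∩ W.noHit1 t

/-- The law of `X_t` conditioned on an event `E` (e.g. survival up to time `t`). -/
def WFKilled.condLaw (W : WFKilled s σ r μ₀) (E : Set W.Ω) (t : ℝ) : Measure ℝ :=
  (W.P E)⁻¹ • (W.P.restrict E).map (W.X t)

/-- The hitting time of `0`, as an element of `ℝ≥0∞`. -/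
def WFKilled.hit0 (W : WFKilled s σ r μ₀) (ω : W.Ω) : ℝ≥0∞ :=
  sInf {t : ℝ≥0∞ | ∃ u : ℝ, 0 ≤ u ∧ t = ENNReal.ofReal u ∧ W.X u ω = 0}

/-- The hitting time of `1`, as an element of `ℝ≥0∞`. -/
def WFKilled.hit1 (W : WFKilled s σ r μ₀) (ω : W.Ω) : ℝ≥0∞ :=
  sInf {t : ℝ≥0∞ | ∃ u : ℝ, 0 ≤ u ∧ t = ENNReal.ofReal u ∧ W.X u ω = 1}

/-- The soft killing time `τ_∂`, as an element of `ℝ≥0∞`. -/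
def WFKilled.killT (W : WFKilled s σ r μ₀) (ω : W.Ω) : ℝ≥0∞ :=
  sInf {t : ℝ≥0∞ | ∃ u : ℝ, 0 ≤ u ∧ t = ENNReal.ofReal u ∧
    W.Tkill ω ≤ ∫ v in Ioc (0:ℝ) u, (-(r (W.X v ω)))}

/-- Quasi-stationary distribution on `(0,1)` for the extinction time `τ_{0,1,∂}`,
with extinction rate `ρ`: under any realization of the killed Wright–Fisher diffusion
started from `α`, one has `ℙ_α(X_t ∈ A ; t < τ_{0,1,∂}) = e^{-ρ t} α(A)`. -/
def IsQSD (s σ : ℝ) (r : ℝ → ℝ) (α : Measure ℝ) (ρ : ℝ) : Prop :=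
  IsProbabilityMeasure α ∧ α (Ioo (0:ℝ) 1)ᶜ = 0 ∧
  ∀ W : WFKilled s σ r α, ∀ t : ℝ, 0 < t → ∀ A : Set ℝ, MeasurableSet A →
    W.P ({ω | W.X t ω ∈ A} ∩ W.aliveAll t) = ENNReal.ofReal (Real.exp (-(ρ * t))) * α A

/-- Quasi-stationary distribution on `[0,1]` for the soft killing time `τ_∂` alone,
with extinction rate `ρ`. -/
def IsQSDsoft (s σ : ℝ) (r : ℝ → ℝ) (α : Measure ℝ) (ρ : ℝ) : Prop :=
  IsProbabilityMeasure α ∧ α (Icc (0:ℝ) 1)ᶜ = 0 ∧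
  ∀ W : WFKilled s σ r α, ∀ t : ℝ, 0 < t → ∀ A : Set ℝ, MeasurableSet A →
    W.P ({ω | W.X t ω ∈ A} ∩ W.aliveSoft t) = ENNReal.ofReal (Real.exp (-(ρ * t))) * α A

/-- Survival capacity `η` with extinction rate `ρ`:
`η(x) = e^{ρ t} 𝔼_x[η(X_t) ; t < τ_{0,1,∂}]`. -/
def IsSurvCap (s σ : ℝ) (r : ℝ → ℝ) (ρ : ℝ) (η : ℝ → ℝ) : Prop :=
  Measurable η ∧ ∀ x ∈ Icc (0:ℝ) 1, ∀ W : WFKilled s σ r (Measure.dirac x), ∀ t : ℝ, 0 < t →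
    η x = Real.exp (ρ * t) * ∫ ω in W.aliveAll t, η (W.X t ω) ∂W.P

/-- Total variation distance between two (finite) measures on `ℝ`. -/
def tvDist (μ ν : Measure ℝ) : ℝ :=
  ⨆ A : Set ℝ, |(μ A).toReal - (ν A).toReal|

/-- Existence of realizations of the killed Wright–Fisher diffusion from any initial law
on `[0,1]` (granted by the classical well-posedness of the Wright–Fisher SDE). -/
def WFExists (s σ : ℝ) (r : ℝ → ℝ) : Prop :=
  ∀ μ : Measure ℝ, IsProbabilityMeasure μ → μ (Icc (0:ℝ) 1)ᶜ = 0 →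
    Nonempty (WFKilled s σ r μ)


section WFHelpers
open scoped BoundedContinuousFunction
section

def tf (β : ℝ) : ℝ → ℝ := fun x => x * (1 - x) * Real.exp (β * x)

lemma tf_contDiff (β : ℝ) : ContDiff ℝ 2 (tf β) := by
  unfold tf; fun_prop

lemma tf_deriv (β : ℝ) : deriv (tf β) = fun x => ((1 - 2*x) + β * (x*(1-x))) * Real.exp (β*x) := by
  funext x
  have h1 : HasDerivAt (fun x : ℝ => Real.exp (β * x)) (Real.exp (β*x) * (β*1)) x :=
    ((hasDerivAt_id x).const_mul β).exp
  have h2 : HasDerivAt (fun x : ℝ => x * (1-x)) (1*(1-x) + x*(-1)) x :=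
    (hasDerivAt_id x).mul ((hasDerivAt_id x).const_sub 1)
  have := (h2.mul h1).deriv
  unfold tf
  refine this.trans ?_
  ring

lemma tf_deriv2 (β : ℝ) : deriv (deriv (tf β)) =
    fun x => (-2 + 2*β*(1-2*x) + β^2 * (x*(1-x))) * Real.exp (β*x) := by
  rw [tf_deriv]
  funext x
  have h1 : HasDerivAt (fun x : ℝ => Real.exp (β * x)) (Real.exp (β*x) * (β*1)) x :=
    ((hasDerivAt_id x).const_mul β).exp
  have h2 : HasDerivAt (fun x : ℝ => (1 - 2*x) + β * (x*(1-x))) (-(2*1) + β*(1*(1-x) + x*(-1))) x :=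
    (((hasDerivAt_id x).const_mul 2).const_sub 1).add
      (((hasDerivAt_id x).mul ((hasDerivAt_id x).const_sub 1)).const_mul β)
  have := (h2.mul h1).deriv
  refine this.trans ?_
  ring

lemma tf_LWF (s σ : ℝ) (hσ : 0 < σ) (x : ℝ) :
    LWF s σ (tf (s/σ^2)) x ≤ -σ^2 * tf (s/σ^2) x := by
  have key : LWF s σ (tf (s/σ^2)) x = -σ^2 * tf (s/σ^2) x
      - (x*(1-x))^2 * (s^2/(2*σ^2)) * Real.exp (s/σ^2*x) := by
    unfold LWF
    rw [tf_deriv2, tf_deriv]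
    unfold tf
    field_simp
    ring
  rw [key]
  have : 0 ≤ (x*(1-x))^2 * (s^2/(2*σ^2)) * Real.exp (s/σ^2*x) := by positivity
  linarith

lemma LWF_cont (s σ : ℝ) (f : ℝ → ℝ) (hf : ContDiff ℝ 2 f) : Continuous (LWF s σ f) := by
  have h1 : Continuous (deriv f) := hf.continuous_deriv (by norm_num)
  have h2 : Continuous (deriv (deriv f)) := by
    have : ContDiff ℝ 1 (deriv f) := by
      have h := (contDiff_succ_iff_deriv (n := 1) (f := f) (𝕜 := ℝ)).1 (by rw [one_add_one_eq_two]; exact hf)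
      exact h.2.2
    exact this.continuous_deriv le_rfl
  unfold LWF
  fun_prop

lemma cont_bdd (f : ℝ → ℝ) (hf : Continuous f) : ∃ C, 0 ≤ C ∧ ∀ x ∈ Icc (0:ℝ) 1, |f x| ≤ C := by
  obtain ⟨C, hC⟩ := isCompact_Icc.exists_bound_of_continuousOn (s := Icc (0:ℝ) 1) hf.continuousOn
  exact ⟨max C 0, le_max_right _ _, fun x hx => (hC x hx).trans (le_max_left _ _)⟩

section gen
variable {Ω : Type*} [MeasurableSpace Ω] {P : Measure Ω} [IsProbabilityMeasure P] {X : ℝ → Ω → ℝ}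

lemma uncurry_meas (hm : ∀ t, Measurable (X t)) (hc : ∀ ω, Continuous fun t => X t ω) :
    Measurable (Function.uncurry X) :=
  measurable_uncurry_of_continuous_of_measurable hc hm

/-- Fubini for `G * ∫ ψ(X_u)`. -/
lemma fubini_path (hm : ∀ t, Measurable (X t)) (hc : ∀ ω, Continuous fun t => X t ω)
    (h01 : ∀ t ω, X t ω ∈ Icc (0:ℝ) 1) (ψ : ℝ → ℝ) (hψ : Continuous ψ) (G : Ω → ℝ)
    (hG : Measurable G) (hGb : ∃ B, ∀ ω, |G ω| ≤ B) (a b : ℝ) :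
    ∫ ω, G ω * (∫ u in Ioc a b, ψ (X u ω)) ∂P = ∫ u in Ioc a b, ∫ ω, G ω * ψ (X u ω) ∂P := by
  obtain ⟨C, hC0, hC⟩ := cont_bdd ψ hψ
  obtain ⟨B, hB⟩ := hGb
  have hX := uncurry_meas hm hc
  simp_rw [← integral_const_mul]
  rw [integral_integral_swap]
  have : IsFiniteMeasure (volume.restrict (Ioc a b)) := by infer_instance
  refine Integrable.of_bound (C := B * C) ?_ ?_
  · apply Measurable.aestronglyMeasurable
    exact (hG.comp measurable_fst).mul (hψ.measurable.comp (hX.comp measurable_swap))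
  · refine ae_of_all _ fun p => ?_
    simp only [Function.uncurry, norm_mul, Real.norm_eq_abs]
    exact mul_le_mul (hB _) (hC _ (h01 _ _)) (abs_nonneg _) ((abs_nonneg _).trans (hB p.1))

lemma cont_expect (hm : ∀ t, Measurable (X t)) (hc : ∀ ω, Continuous fun t => X t ω)
    (h01 : ∀ t ω, X t ω ∈ Icc (0:ℝ) 1) (ψ : ℝ → ℝ) (hψ : Continuous ψ) (G : Ω → ℝ)
    (hG : Measurable G) (hGb : ∃ B, ∀ ω, |G ω| ≤ B) :
    Continuous fun t => ∫ ω, G ω * ψ (X t ω) ∂P := by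
  obtain ⟨C, hC0, hC⟩ := cont_bdd ψ hψ
  obtain ⟨B, hB⟩ := hGb
  refine continuous_of_dominated (bound := fun _ => B * C) ?_ ?_ (integrable_const _) ?_
  · intro t
    exact (hG.mul (hψ.measurable.comp (hm t))).aestronglyMeasurable
  · refine fun t => ae_of_all _ fun ω => ?_
    simp only [norm_mul, Real.norm_eq_abs]
    exact mul_le_mul (hB _) (hC _ (h01 _ _)) (abs_nonneg _) ((abs_nonneg _).trans (hB ω))
  · exact ae_of_all _ fun ω => continuous_const.mul (hψ.comp (hc ω))

lemma integrable_path (hm : ∀ t, Measurable (X t))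
    (h01 : ∀ t ω, X t ω ∈ Icc (0:ℝ) 1) (ψ : ℝ → ℝ) (hψ : Continuous ψ) (t : ℝ) :
    Integrable (fun ω => ψ (X t ω)) P := by
  obtain ⟨C, hC0, hC⟩ := cont_bdd ψ hψ
  exact Integrable.of_bound (hψ.measurable.comp (hm t)).aestronglyMeasurable C
    (ae_of_all _ fun ω => hC _ (h01 _ _))

end gen

lemma rate_lower (s σ : ℝ) (hσ : 0 < σ) (r : ℝ → ℝ) (α : Measure ℝ) (ρ : ℝ)
    (h : IsQSD s σ r α ρ) (W : WFKilled s σ r α) : σ^2 ≤ ρ := by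
  obtain ⟨hprob, hsupp, hq⟩ := h
  set f := tf (s/σ^2) with hf
  have hfC : ContDiff ℝ 2 f := tf_contDiff _
  have hfc : Continuous f := hfC.continuous
  have hLc := LWF_cont s σ f hfC
  have hfn : ∀ x ∈ Icc (0:ℝ) 1, 0 ≤ f x := fun x hx => by
    have := hx.1; have : 0 ≤ 1 - x := by linarith [hx.2]
    change 0 ≤ x * (1 - x) * Real.exp _
    positivity
  have hmX := W.measX
  set v : ℝ → ℝ := fun t => ∫ ω, f (W.X t ω) ∂W.P with hv
  have hvc : Continuous v := by
    have := cont_expect (P := W.P) W.measX W.contX W.range01 f hfc (fun _ => 1) measurable_const ⟨1, by simp⟩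
    simpa using this
  have hwc : Continuous (fun t => ∫ ω, LWF s σ f (W.X t ω) ∂W.P) := by
    have := cont_expect (P := W.P) W.measX W.contX W.range01 _ hLc (fun _ => 1) measurable_const ⟨1, by simp⟩
    simpa using this
  have hfub : ∀ t, ∫ ω, (∫ u in Ioc 0 t, LWF s σ f (W.X u ω)) ∂W.P
      = ∫ u in Ioc 0 t, ∫ ω, LWF s σ f (W.X u ω) ∂W.P := fun t => by
    have := fubini_path (P := W.P) W.measX W.contX W.range01 _ hLc (fun _ => 1) measurable_const ⟨1, by simp⟩ 0 t
    simpa using this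
  have hv0 : v 0 = ∫ x, f x ∂α := by
    rw [← W.initLaw, integral_map (hmX 0).aemeasurable hfc.aestronglyMeasurable]
  have hpos : 0 < ∫ x, f x ∂α := by
    have hae : ∀ᵐ x ∂α, x ∈ Ioo (0:ℝ) 1 := by
      rw [ae_iff]; exact hsupp
    have hI : Integrable f α := by
      obtain ⟨C, hC0, hC⟩ := cont_bdd f hfc
      refine Integrable.of_bound hfc.aestronglyMeasurable C ?_
      filter_upwards [hae] with x hx using hC x (Ioo_subset_Icc_self hx)
    rw [integral_pos_iff_support_of_nonneg_ae _ hI]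
    · have : α (Function.support f) = 1 := by
        rw [← measure_univ (μ := α)]
        refine measure_congr ?_
        filter_upwards [hae] with x hx
        apply propext
        simp only [hf, tf]
        have h1 := hx.1; have h2 : 0 < 1 - x := by linarith [hx.2]
        have : 0 < x * (1-x) * Real.exp (s/σ^2*x) := by positivity
        exact ⟨fun _ => trivial, fun _ => this.ne'⟩
      rw [this]; exact one_pos
    · filter_upwards [hae] with x hx using hfn x (Ioo_subset_Icc_self hx)
  have hM := W.martProblem f hfC
  have hident : ∀ t, 0 ≤ t → v t - ∫ u in Ioc 0 t, ∫ ω, LWF s σ f (W.X u ω) ∂W.P = v 0 := by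
    intro t ht
    have h1 := hM.setIntegral_eq (i := 0) (j := t) ht (s := univ) MeasurableSet.univ
    simp only [Measure.restrict_univ] at h1
    have h0 := hM.integrable t
    have hfi := integrable_path (P := W.P) W.measX W.range01 f hfc t
    have h2 : Integrable (fun ω => ∫ u in Ioc 0 t, LWF s σ f (W.X u ω)) W.P := by
      have := hfi.sub h0
      refine this.congr (ae_of_all _ fun ω => ?_)
      simp
    rw [integral_sub hfi h2, hfub] at h1
    simp only [Ioc_self, Measure.restrict_empty, integral_zero_measure, sub_zero] at h1
    exact h1.symm
  have hlow : ∀ t, 0 ≤ t → Real.exp (-(ρ*t)) * v 0 ≤ v t := by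
    intro t ht
    rcases ht.eq_or_lt with rfl | ht
    · simp
    have hm : (W.P.restrict (W.aliveAll t)).map (W.X t) = ENNReal.ofReal (Real.exp (-(ρ*t))) • α := by
      ext A hA
      rw [Measure.map_apply (hmX t) hA, Measure.restrict_apply ((hmX t) hA)]
      exact hq W t ht A hA
    have hi : ∫ x, f x ∂((W.P.restrict (W.aliveAll t)).map (W.X t)) = Real.exp (-(ρ*t)) * v 0 := by
      rw [hm, integral_smul_measure, ENNReal.toReal_ofReal (Real.exp_pos _).le, hv0, smul_eq_mul]
    rw [integral_map (hmX t).aemeasurable hfc.aestronglyMeasurable] at hi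
    rw [← hi]
    exact setIntegral_le_integral (integrable_path W.measX W.range01 f hfc t)
      (ae_of_all _ fun ω => hfn _ (W.range01 _ _))
  have hint : ∫ u in Ioc (0:ℝ) 1, ∫ ω, LWF s σ f (W.X u ω) ∂W.P
      ≤ ∫ u in Ioc (0:ℝ) 1, -σ^2 * (Real.exp (-(ρ*u)) * v 0) := by
    refine setIntegral_mono_on ?_ ?_ measurableSet_Ioc ?_
    · exact (hwc.integrableOn_Icc).mono_set Ioc_subset_Icc_self
    · have : Continuous fun u => -σ^2 * (Real.exp (-(ρ*u)) * v 0) := by fun_prop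
      exact (this.integrableOn_Icc).mono_set Ioc_subset_Icc_self
    · intro u hu
      have h1 : ∫ ω, LWF s σ f (W.X u ω) ∂W.P ≤ ∫ ω, -σ^2 * f (W.X u ω) ∂W.P :=
        integral_mono (integrable_path W.measX W.range01 _ hLc u)
          ((integrable_path W.measX W.range01 f hfc u).const_mul _)
          (fun ω => tf_LWF s σ hσ _)
      rw [integral_const_mul] at h1
      have := hlow u hu.1.le
      have h3 : 0 < σ^2 := by positivity
      have : σ^2 * (Real.exp (-(ρ*u)) * v 0) ≤ σ^2 * v u := by gcongr
      change _ ≤ -σ^2 * v u at h1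
      linarith
  have hJ : ρ * ∫ u in Ioc (0:ℝ) 1, Real.exp (-(ρ*u)) = 1 - Real.exp (-ρ) := by
    rw [← intervalIntegral.integral_of_le zero_le_one, ← intervalIntegral.integral_const_mul]
    have : ∀ x ∈ uIcc (0:ℝ) 1, HasDerivAt (fun u => -Real.exp (-(ρ*u))) (ρ * Real.exp (-(ρ*x))) x := by
      intro x _
      have := (((hasDerivAt_id x).const_mul ρ).neg.exp).neg
      refine HasDerivAt.congr_deriv this ?_
      change -(Real.exp (-(ρ * x)) * -(ρ * 1)) = _
      ring
    rw [intervalIntegral.integral_eq_sub_of_hasDerivAt this]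
    · simp; ring
    · apply Continuous.intervalIntegrable; fun_prop
  have hJpos : 0 < ∫ u in Ioc (0:ℝ) 1, Real.exp (-(ρ*u)) := by
    rw [← intervalIntegral.integral_of_le zero_le_one]
    apply intervalIntegral.intervalIntegral_pos_of_pos
    · apply Continuous.intervalIntegrable; fun_prop
    · intro x; positivity
    · norm_num
  have e1 := hident 1 zero_le_one
  have e2 := hlow 1 zero_le_one
  rw [integral_const_mul, integral_mul_const] at hint
  rw [← hv0] at hpos
  set J := ∫ u in Ioc (0:ℝ) 1, Real.exp (-(ρ*u)) with hJdef
  by_contra hcon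
  push Not at hcon
  rw [mul_one] at e2
  have : Real.exp (-ρ) = 1 - ρ * J := by linarith
  rw [this] at e2
  have : 0 < (σ^2 - ρ) * J * v 0 := by
    have : 0 < σ^2 - ρ := by linarith
    positivity
  nlinarith
end

section

structure WFCore (s σ : ℝ) (μ₀ : Measure ℝ) where
  (Ω : Type)
  [mΩ : MeasurableSpace Ω]
  (P : Measure Ω)
  (probP : IsProbabilityMeasure P)
  (X : ℝ → Ω → ℝ)
  (measX : ∀ t, Measurable (X t))
  (contX : ∀ ω, Continuous fun t => X t ω)
  (preZero : ∀ t ≤ (0:ℝ), X t = X 0)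
  (range01 : ∀ t ω, X t ω ∈ Icc (0:ℝ) 1)
  (initLaw : P.map (X 0) = μ₀)
  (core : ∀ f : ℝ → ℝ, ContDiff ℝ 2 f → ∀ a b : ℝ, 0 ≤ a → a ≤ b →
    ∀ (I : Finset (Iic a)) (g : (I → ℝ) →ᵇ ℝ),
    ∫ ω, g (fun i => X i.1.1 ω) *
      (f (X b ω) - f (X a ω) - ∫ u in Ioc a b, LWF s σ f (X u ω)) ∂P = 0)

attribute [instance] WFCore.mΩ WFCore.probP

lemma meas_int {Ω : Type*} [MeasurableSpace Ω] {X : ℝ → Ω → ℝ}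
    (hm : ∀ t, Measurable (X t)) (hc : ∀ ω, Continuous fun t => X t ω) (ψ : ℝ → ℝ)
    (hψ : Continuous ψ) (a b : ℝ) :
    StronglyMeasurable (fun ω => ∫ u in Ioc a b, ψ (X u ω)) := by
  have h : StronglyMeasurable (fun p : Ω × ℝ => ψ (X p.2 p.1)) :=
    (hψ.measurable.comp ((uncurry_meas hm hc).comp measurable_swap)).stronglyMeasurable
  exact h.integral_prod_right

lemma cyl_zero {Ω ι : Type} [MeasurableSpace Ω] {P : Measure Ω} [IsProbabilityMeasure P]
    (Z : ι → Ω → ℝ) (hZ : ∀ i, Measurable (Z i)) (V : Ω → ℝ) (hV : Measurable V)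
    (B : ℝ) (hB : ∀ ω, |V ω| ≤ B)
    (h : ∀ (I : Finset ι) (g : (I → ℝ) →ᵇ ℝ), ∫ ω, g (fun i => Z i ω) * V ω ∂P = 0)
    (A : Set Ω) (hA : MeasurableSet[MeasurableSpace.comap (fun ω i => Z i ω) inferInstance] A) :
    ∫ ω in A, V ω ∂P = 0 := by
  have hVi : Integrable V P := Integrable.of_bound hV.aestronglyMeasurable B (ae_of_all _ hB)
  have hVB : ∀ ω, 0 ≤ V ω + B := fun ω => by linarith [neg_le_of_abs_le (hB ω)]
  have hB0 : ∀ _ : Ω, 0 ≤ B := fun ω => (abs_nonneg _).trans (hB ω)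
  set μ1 := P.withDensity (fun ω => ENNReal.ofReal (V ω + B)) with hμ1
  set μ2 := P.withDensity (fun _ => ENNReal.ofReal B) with hμ2
  have hm1 : Measurable (fun ω => ENNReal.ofReal (V ω + B)) := (hV.add_const B).ennreal_ofReal
  have hm2 : Measurable (fun _ : Ω => ENNReal.ofReal B) := measurable_const
  have f1 : IsFiniteMeasure μ1 := isFiniteMeasure_withDensity_ofReal (hVi.add (integrable_const B)).2
  have f2 : IsFiniteMeasure μ2 := isFiniteMeasure_withDensity_ofReal (integrable_const B).2
  have hZm : Measurable (fun ω i => Z i ω) := measurable_pi_lambda _ hZ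
  have hZI : ∀ I : Finset ι, Measurable (fun ω (i : I) => Z i ω) :=
    fun I => measurable_pi_lambda _ fun i => hZ i
  have hfd : ∀ I : Finset ι, μ1.map (fun ω (i : I) => Z i ω) = μ2.map (fun ω (i : I) => Z i ω) := by
    intro I
    apply ext_of_forall_integral_eq_of_IsFiniteMeasure
    intro g
    have hgm : Measurable g := g.continuous.measurable
    rw [integral_map (hZI I).aemeasurable hgm.aestronglyMeasurable,
      integral_map (hZI I).aemeasurable hgm.aestronglyMeasurable,
      integral_withDensity_eq_integral_toReal_smul hm1 (by simp),
      integral_withDensity_eq_integral_toReal_smul hm2 (by simp)]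
    have hgi : Integrable (fun ω => g (fun i : I => Z i ω)) P :=
      Integrable.of_bound (hgm.comp (hZI I)).aestronglyMeasurable ‖g‖
        (ae_of_all _ fun ω => g.norm_coe_le_norm _)
    have hgV : Integrable (fun ω => g (fun i : I => Z i ω) * V ω) P :=
      hVi.bdd_mul (c := ‖g‖) (hgm.comp (hZI I)).aestronglyMeasurable
        (ae_of_all _ fun ω => g.norm_coe_le_norm _)
    have e : ∀ ω, (ENNReal.ofReal (V ω + B)).toReal • g (fun i : I => Z i ω)
        = g (fun i : I => Z i ω) * V ω + (ENNReal.ofReal B).toReal • g (fun i : I => Z i ω) := by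
      intro ω
      rw [ENNReal.toReal_ofReal (hVB ω), ENNReal.toReal_ofReal (hB0 ω), smul_eq_mul, smul_eq_mul]
      ring
    simp_rw [e]
    have hgs : Integrable (fun ω => (ENNReal.ofReal B).toReal • g (fun i : I => Z i ω)) P :=
      hgi.const_mul (ENNReal.ofReal B).toReal
    rw [integral_add hgV hgs, h, zero_add]
  have hmap : μ1.map (fun ω i => Z i ω) = μ2.map (fun ω i => Z i ω) := by
    have p1 : IsProjectiveLimit (μ1.map (fun ω i => Z i ω))
        (fun I : Finset ι => μ1.map (fun ω (i : I) => Z i ω)) := by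
      intro I
      rw [Measure.map_map (Finset.measurable_restrict _) hZm]; rfl
    have p2 : IsProjectiveLimit (μ2.map (fun ω i => Z i ω))
        (fun I : Finset ι => μ1.map (fun ω (i : I) => Z i ω)) := by
      intro I
      rw [Measure.map_map (Finset.measurable_restrict _) hZm]; exact (hfd I).symm
    exact p1.unique p2
  obtain ⟨S, hS, rfl⟩ := hA
  have hA' : MeasurableSet ((fun ω i => Z i ω) ⁻¹' S) := hZm hS
  have hVBi : Integrable (fun ω => V ω + B) P := hVi.add (integrable_const B)
  have e := congrArg (fun m => m S) hmap
  simp only [Measure.map_apply hZm hS] at e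
  rw [hμ1, hμ2, withDensity_apply _ hA', withDensity_apply _ hA',
    ← ofReal_integral_eq_lintegral_ofReal hVBi.integrableOn
      (ae_of_all _ hVB),
    ← ofReal_integral_eq_lintegral_ofReal (integrable_const B).integrableOn
      (ae_of_all _ hB0), ENNReal.ofReal_eq_ofReal_iff (integral_nonneg hVB) (integral_nonneg hB0),
    integral_add hVi.integrableOn (integrable_const B).integrableOn] at e
  linarith

lemma expMeasure_tail (t : ℝ) (ht : 0 ≤ t) :
    expMeasure 1 (Ioi t) = ENNReal.ofReal (Real.exp (-t)) := by
  have : IsProbabilityMeasure (expMeasure 1) := isProbabilityMeasure_expMeasure one_pos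
  rw [← compl_Iic, prob_compl_eq_one_sub measurableSet_Iic, ← ofReal_cdf, cdf_expMeasure_eq one_pos,
    if_pos ht, ← ENNReal.ofReal_one, ← ENNReal.ofReal_sub]
  · simp
  · simpa using ht

lemma core_to_killed {s σ : ℝ} {μ₀ : Measure ℝ} (r : ℝ → ℝ) (K : WFCore s σ μ₀) :
    Nonempty (WFKilled s σ r μ₀) := by
  have hE : IsProbabilityMeasure (expMeasure 1) := isProbabilityMeasure_expMeasure one_pos
  let Q : Measure (K.Ω × ℝ) := K.P.prod (expMeasure 1)
  let Y : ℝ → K.Ω × ℝ → ℝ := fun t p => K.X t p.1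
  have hY : ∀ t, Measurable (Y t) := fun t => (K.measX t).comp measurable_fst
  have hYc : ∀ p, Continuous fun t => Y t p := fun p => K.contX p.1
  have hY01 : ∀ t p, Y t p ∈ Icc (0:ℝ) 1 := fun t p => K.range01 t p.1
  have hfst : Q.map Prod.fst = K.P := by
    simp [Q, Measure.map_fst_prod]
  let ℱ := Filtration.natural Y (fun t => (hY t).stronglyMeasurable)
  have had : ∀ t u, u ≤ t → Measurable[ℱ t] (Y u) := by
    intro t u hut
    have : Measurable[ℱ u] (Y u) :=
      (Filtration.stronglyAdapted_natural (fun t => (hY t).stronglyMeasurable) u).measurable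
    exact this.mono (ℱ.mono hut) le_rfl
  refine ⟨{ Ω := K.Ω × ℝ, P := Q, probP := inferInstance, X := Y, measX := hY, contX := hYc
            preZero := fun t ht => ?_
            range01 := hY01
            initLaw := ?_
            ℱ := ℱ
            adaptedX := fun t => had t t le_rfl
            martProblem := ?_
            Tkill := Prod.snd
            measT := measurable_snd
            expLaw := ?_
            indepT := ?_ }⟩
  · funext p; exact congrFun (K.preZero t ht) p.1
  · change Q.map (K.X 0 ∘ Prod.fst) = μ₀
    rw [← Measure.map_map (K.measX 0) measurable_fst, hfst, K.initLaw]
  · intro f hf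
    have hfc := hf.continuous
    have hLc := LWF_cont s σ f hf
    obtain ⟨C1, hC10, hC1⟩ := cont_bdd f hfc
    obtain ⟨C2, hC20, hC2⟩ := cont_bdd _ hLc
    set M : ℝ → K.Ω × ℝ → ℝ := fun t ω => f (Y t ω) - ∫ u in Ioc (0:ℝ) t, LWF s σ f (Y u ω) with hM
    have hIm : ∀ a b, Measurable (fun ω => ∫ u in Ioc a b, LWF s σ f (Y u ω)) :=
      fun a b => (meas_int hY hYc _ hLc a b).measurable
    have hIb : ∀ a b ω, |∫ u in Ioc a b, LWF s σ f (Y u ω)| ≤ C2 * (volume.real (Ioc a b)) := by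
      intro a b ω
      rw [← Real.norm_eq_abs]
      refine norm_setIntegral_le_of_norm_le_const measure_Ioc_lt_top (fun u _ => ?_)
      rw [Real.norm_eq_abs]
      exact hC2 _ (hY01 _ _)
    have hMm : ∀ t, Measurable (M t) := fun t => (hfc.measurable.comp (hY t)).sub (hIm 0 t)
    have hMi : ∀ t, Integrable (M t) Q := by
      intro t
      refine Integrable.of_bound (hMm t).aestronglyMeasurable (C1 + C2 * (volume.real (Ioc 0 t))) ?_
      refine ae_of_all _ fun ω => ?_
      exact (norm_sub_le _ _).trans (add_le_add (hC1 _ (hY01 _ _)) (hIb _ _ _))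
    have hMad : ∀ t, StronglyMeasurable[ℱ t] (M t) := by
      intro t
      have h1 : StronglyMeasurable[ℱ t] (fun ω => f (Y t ω)) :=
        (hfc.measurable.comp (had t t le_rfl)).stronglyMeasurable
      have h2 := @meas_int _ (ℱ t) (fun u ω => Y (min u t) ω) (fun u => had t _ (min_le_right _ _))
        (fun ω => (hYc ω).comp (continuous_id.min continuous_const)) _ hLc 0 t
      have h3 : (fun ω => ∫ u in Ioc (0:ℝ) t, LWF s σ f (Y (min u t) ω))
          = fun ω => ∫ u in Ioc (0:ℝ) t, LWF s σ f (Y u ω) := by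
        funext ω
        refine setIntegral_congr_fun measurableSet_Ioc fun u hu => ?_
        simp only [min_eq_left hu.2]
      rw [h3] at h2
      exact h1.sub h2
    have hmain : ∀ a b, 0 ≤ a → a ≤ b → ∀ A, MeasurableSet[ℱ a] A →
        ∫ ω in A, M a ω ∂Q = ∫ ω in A, M b ω ∂Q := by
      intro a b ha hab A hA
      have hA' : MeasurableSet[MeasurableSpace.comap (fun ω (i : Iic a) => Y i ω) inferInstance] A := by
        rw [← Filtration.natural_eq_comap Y (fun t => (hY t).stronglyMeasurable) a]; exact hA
      have hV : ∀ ω, M b ω - M a ω = f (Y b ω) - f (Y a ω) - ∫ u in Ioc a b, LWF s σ f (Y u ω) := by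
        intro ω
        have hc : Continuous fun u => LWF s σ f (Y u ω) := hLc.comp (hYc ω)
        have e : ∫ u in Ioc 0 b, LWF s σ f (Y u ω) = (∫ u in Ioc 0 a, LWF s σ f (Y u ω))
            + ∫ u in Ioc a b, LWF s σ f (Y u ω) := by
          rw [← intervalIntegral.integral_of_le ha, ← intervalIntegral.integral_of_le hab,
            ← intervalIntegral.integral_of_le (ha.trans hab),
            intervalIntegral.integral_add_adjacent_intervals] <;>
          exact hc.intervalIntegrable _ _
        simp only [hM]
        rw [e]; ring
      have h0 := cyl_zero (P := Q) (fun (i : Iic a) => Y i) (fun i => hY i)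
        (fun ω => f (Y b ω) - f (Y a ω) - ∫ u in Ioc a b, LWF s σ f (Y u ω))
        (((hfc.measurable.comp (hY b)).sub (hfc.measurable.comp (hY a))).sub (hIm a b))
        (C1 + C1 + C2 * (volume.real (Ioc a b)))
        (fun ω => (abs_sub _ _).trans (add_le_add ((abs_sub _ _).trans
          (add_le_add (hC1 _ (hY01 _ _)) (hC1 _ (hY01 _ _)))) (hIb _ _ _)))
        (fun I g => by
          have := K.core f hf a b ha hab I g
          rw [← hfst, integral_map] at this
          · exact this
          · exact measurable_fst.aemeasurable
          · refine Measurable.aestronglyMeasurable ?_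
            refine (g.continuous.measurable.comp (measurable_pi_lambda _ fun i => K.measX _)).mul ?_
            exact ((hfc.measurable.comp (K.measX b)).sub (hfc.measurable.comp (K.measX a))).sub
              (meas_int K.measX K.contX _ hLc a b).measurable)
        A hA'
      simp_rw [← hV] at h0
      rw [integral_sub (hMi b).integrableOn (hMi a).integrableOn] at h0
      linarith
    have hMneg : ∀ t, M t = M (max t 0) := by
      intro t
      rcases le_total 0 t with h | h
      · rw [max_eq_left h]
      · rw [max_eq_right h]
        funext ω
        have e : Y t = Y 0 := by funext p; exact congrFun (K.preZero t h) p.1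
        simp only [hM, Ioc_eq_empty_of_le h, Ioc_self, e]
    refine ⟨hMad, fun i j hij => ?_⟩
    refine (ae_eq_condExp_of_forall_setIntegral_eq (ℱ.le i) (hMi j)
      (fun A _ _ => (hMi i).integrableOn) (fun A hA _ => ?_) (hMad i).aestronglyMeasurable).symm
    rw [hMneg i, hMneg j]
    exact hmain _ _ (le_max_right _ _) (max_le_max_right _ hij) A (ℱ.mono (le_max_left i 0) A hA)
  · intro t ht
    have : {ω : K.Ω × ℝ | t < ω.2} = univ ×ˢ Ioi t := by ext; simp
    rw [this, Measure.prod_prod, measure_univ, one_mul, expMeasure_tail t ht]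
  · exact indepFun_prod (X := fun ω t => K.X t ω) (Y := id) (measurable_pi_lambda _ K.measX) measurable_id
end

section

def dy (n : ℕ) (t : ℝ) : ℚ := (⌊t * 2^n⌋₊ : ℚ) / 2^n

lemma dy_nonneg (n : ℕ) (t : ℝ) : 0 ≤ dy n t := by unfold dy; positivity

lemma dy_mono (n : ℕ) {a b : ℝ} (h : a ≤ b) : dy n a ≤ dy n b := by
  unfold dy
  have : ⌊a * 2^n⌋₊ ≤ ⌊b * 2^n⌋₊ := Nat.floor_le_floor (by gcongr)
  gcongr

lemma dy_nonpos (n : ℕ) {t : ℝ} (h : t ≤ 0) : dy n t = 0 := by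
  unfold dy
  rw [Nat.floor_of_nonpos (mul_nonpos_of_nonpos_of_nonneg h (by positivity))]
  simp

lemma dy_tendsto {t : ℝ} (h : 0 ≤ t) : Tendsto (fun n => ((dy n t : ℚ) : ℝ)) atTop (𝓝 t) := by
  have h1 : Tendsto (fun n : ℕ => t - (1/2:ℝ)^n) atTop (𝓝 t) := by
    have := (tendsto_pow_atTop_nhds_zero_of_lt_one (r := (1/2:ℝ)) (by norm_num) (by norm_num)).const_sub t
    simpa using this
  refine tendsto_of_tendsto_of_tendsto_of_le_of_le h1 tendsto_const_nhds (fun n => ?_) (fun n => ?_)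
  · have := (Nat.lt_floor_add_one (t * 2^n)).le
    simp only [dy]; push_cast
    rw [le_div_iff₀ (by positivity), sub_mul, ← mul_pow]
    norm_num; linarith
  · have := Nat.floor_le (a := t * 2^n) (by positivity)
    simp only [dy]; push_cast
    rw [div_le_iff₀ (by positivity)]
    exact this

def GoodT (y : ℚ → ℝ) (T C : ℕ) : Prop :=
  ∀ n k : ℕ, k < T * 2^n → |y ((k+1:ℚ)/2^n) - y ((k:ℚ)/2^n)| ≤ C * (9/10)^n

def GoodP (y : ℚ → ℝ) : Prop := ∀ T : ℕ, ∃ C : ℕ, GoodT y T C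

lemma good_step {y : ℚ → ℝ} {T C : ℕ} (h : GoodT y T C) {t : ℝ} (ht : t ≤ T) (n : ℕ) :
    dist (y (dy n t)) (y (dy (n+1) t)) ≤ C * (9/10)^n := by
  rcases le_total t 0 with h0 | h0
  · rw [dy_nonpos _ h0, dy_nonpos _ h0]; simp; positivity
  set k := ⌊t * 2^n⌋₊ with hk
  have hk1 : (k:ℝ) ≤ t * 2^n := Nat.floor_le (by positivity)
  have hk2 : t * 2^n < k + 1 := Nat.lt_floor_add_one _
  have e1 : dy n t = ((2*k:ℕ):ℚ) / 2^(n+1) := by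
    simp only [dy]; rw [← hk]; push_cast; rw [pow_succ]; field_simp
  have hlo : 2*k ≤ ⌊t * 2^(n+1)⌋₊ := Nat.le_floor (by push_cast; rw [pow_succ]; linarith)
  have hhi : ⌊t * 2^(n+1)⌋₊ < 2*k+2 := by
    rw [Nat.floor_lt (by positivity)]; push_cast; rw [pow_succ]; linarith
  have hcase : ⌊t * 2^(n+1)⌋₊ = 2*k ∨ ⌊t * 2^(n+1)⌋₊ = 2*k+1 := by omega
  rcases hcase with hc | hc
  · have e2 : dy (n+1) t = ((2*k:ℕ):ℚ) / 2^(n+1) := by simp only [dy]; rw [hc]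
    rw [e1, e2, dist_self]; positivity
  · have e2 : dy (n+1) t = (((2*k:ℕ):ℚ)+1) / 2^(n+1) := by simp only [dy]; rw [hc]; push_cast; ring
    have hlt : 2*k < T * 2^(n+1) := by
      have : ((2*k+1:ℕ):ℝ) ≤ t * 2^(n+1) := by rw [← hc]; exact Nat.floor_le (by positivity)
      have h2 : t * 2^(n+1) ≤ T * 2^(n+1) := by gcongr
      have h3 : ((2*k+1:ℕ):ℝ) ≤ ((T * 2^(n+1) : ℕ):ℝ) := by push_cast at *; linarith
      have := Nat.cast_le.1 h3
      omega
    have := h (n+1) (2*k) hlt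
    rw [e1, e2, dist_comm, Real.dist_eq]
    refine this.trans ?_
    rw [pow_succ]
    have : (0:ℝ) ≤ C * (9/10)^n := by positivity
    linarith

def plim (y : ℚ → ℝ) (t : ℝ) : ℝ := limUnder atTop (fun n => y (dy n t))

lemma plim_tendsto {y : ℚ → ℝ} (h : GoodP y) (t : ℝ) :
    Tendsto (fun n => y (dy n t)) atTop (𝓝 (plim y t)) := by
  obtain ⟨T, hT⟩ := exists_nat_ge t
  obtain ⟨C, hC⟩ := h T
  exact (cauchySeq_of_le_geometric (9/10) C (by norm_num) (good_step hC hT)).tendsto_limUnder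

lemma plim_dist {y : ℚ → ℝ} (h : GoodP y) {T C : ℕ} (hC : GoodT y T C) {t : ℝ} (ht : t ≤ T) (n : ℕ) :
    dist (y (dy n t)) (plim y t) ≤ 10 * C * (9/10)^n := by
  have := dist_le_of_le_geometric_of_tendsto (9/10) (C:ℝ) (by norm_num) (good_step hC ht)
    (plim_tendsto h t) n
  refine this.trans (le_of_eq ?_)
  norm_num; ring

lemma good_near {y : ℚ → ℝ} {T C : ℕ} (h : GoodT y T C) {a b : ℝ} (hab : a ≤ b) (hb : b ≤ T) (n : ℕ)
    (hd : (b - a) * 2^n < 1) :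
    dist (y (dy n a)) (y (dy n b)) ≤ C * (9/10)^n := by
  have hlo : ⌊a * 2^n⌋₊ ≤ ⌊b * 2^n⌋₊ := Nat.floor_le_floor (by gcongr)
  have hhi : ⌊b * 2^n⌋₊ ≤ ⌊a * 2^n⌋₊ + 1 := by
    have h2 : b * 2^n < (⌊a * 2^n⌋₊ + 2 : ℕ) := by
      have := Nat.lt_floor_add_one (a * 2^n)
      push_cast; nlinarith
    have := Nat.floor_lt' (a := b * 2^n) (n := ⌊a * 2^n⌋₊ + 2) (by omega) |>.2 h2
    omega
  have hcase : ⌊b * 2^n⌋₊ = ⌊a * 2^n⌋₊ ∨ ⌊b * 2^n⌋₊ = ⌊a * 2^n⌋₊ + 1 := by omega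
  rcases hcase with hc | hc
  · have : dy n b = dy n a := by simp only [dy]; rw [hc]
    rw [this, dist_self]; positivity
  · have e2 : dy n b = ((⌊a * 2^n⌋₊:ℚ)+1) / 2^n := by simp only [dy]; rw [hc]; push_cast; ring
    have hlt : ⌊a * 2^n⌋₊ < T * 2^n := by
      have hb0 : 0 ≤ b * 2^n := by
        by_contra hneg
        rw [Nat.floor_of_nonpos (by linarith)] at hc; omega
      have : ((⌊a * 2^n⌋₊+1:ℕ):ℝ) ≤ b * 2^n := by rw [← hc]; exact Nat.floor_le hb0
      have h2 : b * 2^n ≤ T * 2^n := by gcongr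
      have h3 : ((⌊a * 2^n⌋₊+1:ℕ):ℝ) ≤ ((T * 2^n : ℕ):ℝ) := by push_cast at *; linarith
      have := Nat.cast_le.1 h3
      omega
    have := h n _ hlt
    rw [e2, dist_comm, Real.dist_eq]
    exact this

lemma plim_cont {y : ℚ → ℝ} (h : GoodP y) : Continuous (plim y) := by
  rw [Metric.continuous_iff]
  intro b ε hε
  obtain ⟨T, hT⟩ := exists_nat_ge (b + 1)
  obtain ⟨C, hC⟩ := h T
  have hlim : Tendsto (fun n : ℕ => 21 * (C:ℝ) * (9/10)^n) atTop (𝓝 0) := by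
    have := (tendsto_pow_atTop_nhds_zero_of_lt_one (r := (9/10:ℝ)) (by norm_num) (by norm_num)).const_mul (21 * (C:ℝ))
    simpa using this
  obtain ⟨n, hn⟩ := (hlim.eventually (gt_mem_nhds hε)).exists
  have h2 : (0:ℝ) < (2:ℝ)^n := by positivity
  refine ⟨min 1 (1/2^n), by positivity, fun a ha => ?_⟩
  have ha1 : |a - b| < 1 := lt_of_lt_of_le ha (min_le_left _ _)
  have ha2 : |a - b| * 2^n < 1 := by
    have := lt_of_lt_of_le ha (min_le_right _ _)
    rw [lt_div_iff₀ h2] at this; exact this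
  have haT : a ≤ T := by linarith [(abs_lt.1 ha1).2]
  have hbT : b ≤ T := by linarith
  have hnear : dist (y (dy n a)) (y (dy n b)) ≤ C * (9/10)^n := by
    rcases le_total a b with hab | hab
    · refine good_near hC hab hbT n ?_
      rwa [abs_sub_comm, abs_of_nonneg (by linarith)] at ha2
    · rw [dist_comm]
      refine good_near hC hab haT n ?_
      rwa [abs_of_nonneg (by linarith)] at ha2
  have d1 := plim_dist h hC haT n
  have d2 := plim_dist h hC hbT n
  have t1 := dist_triangle (plim y a) (y (dy n a)) (plim y b)
  have t2 := dist_triangle (y (dy n a)) (y (dy n b)) (plim y b)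
  rw [dist_comm (plim y a) (y (dy n a))] at t1
  have : (10 * C * (9/10)^n + (C * (9/10)^n + 10 * C * (9/10)^n) : ℝ) = 21 * C * (9/10)^n := by ring
  linarith

section good
variable {Ω : Type} [MeasurableSpace Ω] {P : Measure Ω} [IsProbabilityMeasure P] {Y : ℚ → Ω → ℝ}

lemma good_meas (hY : ∀ q, Measurable (Y q)) : MeasurableSet {ω | GoodP (fun q => Y q ω)} := by
  have : {ω | GoodP (fun q => Y q ω)} = ⋂ T : ℕ, ⋃ C : ℕ, ⋂ n : ℕ, ⋂ k : ℕ, ⋂ _ : k < T * 2^n,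
      {ω | |Y ((k+1:ℚ)/2^n) ω - Y ((k:ℚ)/2^n) ω| ≤ C * (9/10)^n} := by
    ext ω; simp [GoodP, GoodT]
  rw [this]
  refine MeasurableSet.iInter fun T => MeasurableSet.iUnion fun C => MeasurableSet.iInter fun n =>
    MeasurableSet.iInter fun k => MeasurableSet.iInter fun _ => ?_
  exact measurableSet_le (continuous_abs.measurable.comp ((hY _).sub (hY _))) measurable_const

lemma good_ae (hY : ∀ q, Measurable (Y q)) (h01 : ∀ q ω, Y q ω ∈ Icc (0:ℝ) 1) (C : ℝ)
    (hC : ∀ p q : ℚ, 0 ≤ p → p ≤ q → ∫ ω, (Y q ω - Y p ω)^4 ∂P ≤ C * ((q - p : ℚ):ℝ)^2) :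
    ∀ᵐ ω ∂P, GoodP (fun q => Y q ω) := by
  unfold GoodP
  rw [ae_all_iff]
  intro T
  let a : ℕ → ℕ → Ω → ℝ := fun n k ω => (Y ((k+1:ℚ)/2^n) ω - Y ((k:ℚ)/2^n) ω)^4
  have ham : ∀ n k, Measurable (a n k) := fun n k => ((hY _).sub (hY _)).pow_const 4
  have ha0 : ∀ n k ω, 0 ≤ a n k ω := fun n k ω => by positivity
  have hab : ∀ n k ω, |a n k ω| ≤ 1 := by
    intro n k ω
    rw [abs_of_nonneg (ha0 n k ω)]
    have h1 := h01 ((k+1:ℚ)/2^n) ω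
    have h2 := h01 ((k:ℚ)/2^n) ω
    have : |Y ((k+1:ℚ)/2^n) ω - Y ((k:ℚ)/2^n) ω| ≤ 1 := abs_sub_le_iff.2 ⟨by linarith [h1.2, h2.1], by linarith [h2.2, h1.1]⟩
    simp only [a]
    rw [← Even.pow_abs (by decide)]
    exact pow_le_one₀ (abs_nonneg _) this
  have hai : ∀ n k, Integrable (a n k) P := fun n k =>
    Integrable.of_bound (ham n k).aestronglyMeasurable 1 (ae_of_all _ (hab n k))
  let F : ℕ → Ω → ℝ≥0∞ := fun n ω => ENNReal.ofReal ((10000/6561)^n * ∑ k ∈ Finset.range (T * 2^n), a n k ω)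
  have hFm : ∀ n, Measurable (F n) := fun n =>
    ((Finset.measurable_sum _ fun k _ => ham n k).const_mul _).ennreal_ofReal
  have hFi : ∀ n, ∫⁻ ω, F n ω ∂P ≤ ENNReal.ofReal (C * T * (5000/6561)^n) := by
    intro n
    have hs : Integrable (fun ω => ∑ k ∈ Finset.range (T * 2^n), a n k ω) P :=
      integrable_finsetSum _ fun k _ => hai n k
    rw [← ofReal_integral_eq_lintegral_ofReal (hs.const_mul _)
      (ae_of_all _ fun ω => mul_nonneg (by positivity) (Finset.sum_nonneg fun k _ => ha0 n k ω))]
    apply ENNReal.ofReal_le_ofReal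
    rw [integral_const_mul, integral_finsetSum _ fun k _ => hai n k]
    have : ∑ k ∈ Finset.range (T * 2^n), ∫ ω, a n k ω ∂P
        ≤ ∑ k ∈ Finset.range (T * 2^n), C * (1/2^n)^2 := by
      refine Finset.sum_le_sum fun k _ => ?_
      have := hC ((k:ℚ)/2^n) ((k+1:ℚ)/2^n) (by positivity) (by gcongr; linarith)
      refine this.trans (le_of_eq ?_)
      congr 2
      push_cast
      field_simp
      ring
    rw [Finset.sum_const, Finset.card_range, nsmul_eq_mul] at this
    calc _ ≤ (10000/6561:ℝ)^n * (((T * 2^n : ℕ):ℝ) * (C * (1/2^n)^2)) := by gcongr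
      _ = C * T * (5000/6561)^n := by
        have : (5000/6561:ℝ) = (10000/6561) * (1/2) := by norm_num
        rw [this, mul_pow (10000/6561:ℝ)]
        push_cast
        have h2 : (2:ℝ)^n ≠ 0 := by positivity
        have h3 : ((1:ℝ)/2)^n = 1/2^n := one_div_pow 2 n
        rw [h3]
        field_simp
  have hsum : ∫⁻ ω, ∑' n, F n ω ∂P ≠ ∞ := by
    rw [lintegral_tsum fun n => (hFm n).aemeasurable]
    refine ne_top_of_le_ne_top ?_ (ENNReal.tsum_le_tsum hFi)
    have hS : Summable (fun n : ℕ => C * T * (5000/6561:ℝ)^n) :=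
      (summable_geometric_of_lt_one (by norm_num) (by norm_num)).mul_left _
    exact hS.tsum_ofReal_ne_top
  have hae := ae_lt_top (Measurable.tsum hFm) hsum
  filter_upwards [hae] with ω hω
  set S := (∑' n, F n ω).toReal with hSdef
  obtain ⟨N, hN⟩ := exists_nat_ge (max S 1)
  refine ⟨N, fun n k hk => ?_⟩
  have h1 : F n ω ≤ ∑' n, F n ω := ENNReal.le_tsum n
  have h2 : (10000/6561)^n * ∑ k ∈ Finset.range (T * 2^n), a n k ω ≤ S := by
    have := (ENNReal.ofReal_le_iff_le_toReal hω.ne).1 h1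
    exact this
  have h3 : a n k ω ≤ ∑ k ∈ Finset.range (T * 2^n), a n k ω :=
    Finset.single_le_sum (fun k _ => ha0 n k ω) (Finset.mem_range.2 hk)
  have h4 : (10000/6561:ℝ)^n * a n k ω ≤ S := le_trans (by gcongr) h2
  set x := |Y ((k+1:ℚ)/2^n) ω - Y ((k:ℚ)/2^n) ω| with hx
  have h5 : ((10/9:ℝ)^n * x)^4 ≤ S := by
    have : ((10/9:ℝ)^n * x)^4 = (10000/6561:ℝ)^n * a n k ω := by
      rw [mul_pow, hx, Even.pow_abs (by decide), ← pow_mul, mul_comm n, pow_mul]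
      norm_num [a]
    rw [this]; exact h4
  have h6 : (10/9:ℝ)^n * x ≤ N := by
    by_contra hcon
    push Not at hcon
    have hz1 : 1 < (10/9:ℝ)^n * x := lt_of_le_of_lt ((le_max_right _ _).trans hN) hcon
    have : (10/9:ℝ)^n * x ≤ ((10/9:ℝ)^n * x)^4 := le_self_pow₀ hz1.le (by norm_num)
    have := (le_max_left S 1).trans hN
    linarith
  have h7 : x = (9/10:ℝ)^n * ((10/9:ℝ)^n * x) := by
    rw [← mul_assoc, ← mul_pow]; norm_num
  rw [h7, mul_comm (N:ℝ)]
  gcongr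
end good
end

section

section transfer
variable {Ω : Type} [MeasurableSpace Ω] {P : Measure Ω} [IsProbabilityMeasure P] {Y : ℚ → Ω → ℝ}

open Classical in
def Xlim (Y : ℚ → Ω → ℝ) (t : ℝ) (ω : Ω) : ℝ :=
  if GoodP (fun q => Y q ω) then plim (fun q => Y q ω) t else Y 0 ω

open Classical in
lemma Xlim_tendsto (Y : ℚ → Ω → ℝ) (t : ℝ) (ω : Ω) :
    Tendsto (fun n => if GoodP (fun q => Y q ω) then Y (dy n t) ω else Y 0 ω) atTop (𝓝 (Xlim Y t ω)) := by
  unfold Xlim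
  by_cases h : GoodP (fun q => Y q ω)
  · simp only [h, if_true]; exact plim_tendsto h t
  · simp only [h, if_false]; exact tendsto_const_nhds

lemma Xlim_tendsto' {ω : Ω} (h : GoodP (fun q => Y q ω)) (t : ℝ) :
    Tendsto (fun n => Y (dy n t) ω) atTop (𝓝 (Xlim Y t ω)) := by
  have := Xlim_tendsto Y t ω
  simpa only [h, if_true] using this

lemma Xlim_meas (hY : ∀ q, Measurable (Y q)) (t : ℝ) : Measurable (Xlim Y t) := by
  classical
  refine measurable_of_tendsto_metrizable (f := fun n ω => if GoodP (fun q => Y q ω) then Y (dy n t) ω else Y 0 ω)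
    (fun n => Measurable.ite (good_meas hY) (hY _) (hY _)) ?_
  rw [tendsto_pi_nhds]
  exact fun ω => Xlim_tendsto Y t ω

lemma Xlim_cont (Y : ℚ → Ω → ℝ) (ω : Ω) : Continuous fun t => Xlim Y t ω := by
  unfold Xlim
  by_cases h : GoodP (fun q => Y q ω)
  · simp only [h, if_true]; exact plim_cont h
  · simp only [h, if_false]; exact continuous_const

lemma Xlim_nonpos (Y : ℚ → Ω → ℝ) {t : ℝ} (ht : t ≤ 0) : Xlim Y t = Y 0 := by
  classical
  ext ω
  refine tendsto_nhds_unique (Xlim_tendsto Y t ω) ?_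
  simp only [dy_nonpos _ ht, ite_self]; exact tendsto_const_nhds

lemma Xlim_range (h01 : ∀ q ω, Y q ω ∈ Icc (0:ℝ) 1) (t : ℝ) (ω : Ω) : Xlim Y t ω ∈ Icc (0:ℝ) 1 := by
  classical
  refine isClosed_Icc.mem_of_tendsto (Xlim_tendsto Y t ω) (Eventually.of_forall fun n => ?_)
  split_ifs <;> exact h01 _ _

def LocalMart (s σ : ℝ) (P : Measure Ω) (Y : ℚ → Ω → ℝ) : Prop :=
  ∀ f : ℝ → ℝ, ContDiff ℝ 2 f → ∀ ε : ℝ, 0 < ε → ∃ δ : ℝ, 0 < δ ∧ ∀ p q : ℚ, 0 ≤ p → p ≤ q →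
    ((q - p : ℚ) : ℝ) < δ → ∀ (ι : Type) [Fintype ι] (u : ι → ℚ), (∀ i, 0 ≤ u i ∧ u i ≤ p) →
    ∀ g : (ι → ℝ) →ᵇ ℝ,
    |∫ ω, g (fun i => Y (u i) ω) * (f (Y q ω) - f (Y p ω) - ((q - p : ℚ) : ℝ) * LWF s σ f (Y p ω)) ∂P|
      ≤ ε * ((q - p : ℚ) : ℝ) * ‖g‖

lemma local_real {s σ : ℝ} (hY : ∀ q, Measurable (Y q)) (h01 : ∀ q ω, Y q ω ∈ Icc (0:ℝ) 1)
    (hg : ∀ᵐ ω ∂P, GoodP (fun q => Y q ω)) (H : LocalMart s σ P Y)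
    (f : ℝ → ℝ) (hf : ContDiff ℝ 2 f) (ε : ℝ) (hε : 0 < ε) :
    ∃ δ : ℝ, 0 < δ ∧ ∀ a b : ℝ, 0 ≤ a → a ≤ b → b - a < δ → ∀ (ι : Type) [Fintype ι] (u : ι → ℝ),
    (∀ i, u i ≤ a) → ∀ g : (ι → ℝ) →ᵇ ℝ,
    |∫ ω, g (fun i => Xlim Y (u i) ω) * (f (Xlim Y b ω) - f (Xlim Y a ω)
        - (b - a) * LWF s σ f (Xlim Y a ω)) ∂P| ≤ ε * (b - a) * ‖g‖ := by
  obtain ⟨δ, hδ, h⟩ := H f hf ε hε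
  refine ⟨δ, hδ, fun a b ha hab hd ι _ u hu g => ?_⟩
  have hLc := LWF_cont s σ f hf
  obtain ⟨Cf, hCf0, hCf⟩ := cont_bdd f hf.continuous
  obtain ⟨CL, hCL0, hCL⟩ := cont_bdd _ hLc
  have tb := dy_tendsto (ha.trans hab)
  have ta := dy_tendsto ha
  have td : Tendsto (fun n => ((dy n b - dy n a : ℚ):ℝ)) atTop (𝓝 (b - a)) := by
    push_cast; exact tb.sub ta
  have hlim : Tendsto (fun n => ∫ ω, g (fun i => Y (dy n (u i)) ω) * (f (Y (dy n b) ω) - f (Y (dy n a) ω)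
      - ((dy n b - dy n a : ℚ) : ℝ) * LWF s σ f (Y (dy n a) ω)) ∂P) atTop
      (𝓝 (∫ ω, g (fun i => Xlim Y (u i) ω) * (f (Xlim Y b ω) - f (Xlim Y a ω)
        - (b - a) * LWF s σ f (Xlim Y a ω)) ∂P)) := by
    refine tendsto_integral_filter_of_dominated_convergence
      (bound := fun _ => ‖g‖ * (Cf + Cf + (|b - a| + 1) * CL)) ?_ ?_ (integrable_const _) ?_
    · refine Eventually.of_forall fun n => Measurable.aestronglyMeasurable ?_
      refine (g.continuous.measurable.comp (measurable_pi_lambda _ fun i => hY _)).mul ?_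
      exact ((hf.continuous.measurable.comp (hY _)).sub (hf.continuous.measurable.comp (hY _))).sub
        ((hLc.measurable.comp (hY _)).const_mul _)
    · have : ∀ᶠ n in atTop, |((dy n b - dy n a : ℚ):ℝ)| < |b - a| + 1 :=
        (td.abs).eventually (gt_mem_nhds (by linarith))
      filter_upwards [this] with n hn
      refine ae_of_all _ fun ω => ?_
      rw [norm_mul]
      refine mul_le_mul (g.norm_coe_le_norm _) ?_ (norm_nonneg _) (norm_nonneg _)
      refine (norm_sub_le _ _).trans (add_le_add ((norm_sub_le _ _).trans (add_le_add ?_ ?_)) ?_)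
      · exact hCf _ (h01 _ _)
      · exact hCf _ (h01 _ _)
      · rw [norm_mul]
        exact mul_le_mul hn.le (hCL _ (h01 _ _)) (norm_nonneg _) (by positivity)
    · filter_upwards [hg] with ω hω
      have t := Xlim_tendsto' hω
      refine Tendsto.mul ?_ ?_
      · exact (g.continuous.tendsto _).comp (tendsto_pi_nhds.2 fun i => t (u i))
      · refine (((hf.continuous.tendsto _).comp (t b)).sub ((hf.continuous.tendsto _).comp (t a))).sub ?_
        exact td.mul ((hLc.tendsto _).comp (t a))
  refine le_of_tendsto_of_tendsto hlim.abs ((td.const_mul ε).mul_const ‖g‖) ?_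
  have : ∀ᶠ n in atTop, ((dy n b - dy n a : ℚ):ℝ) < δ := td.eventually (gt_mem_nhds hd)
  filter_upwards [this] with n hn
  exact h (dy n a) (dy n b) (dy_nonneg _ _) (dy_mono n hab) hn ι (fun i => dy n (u i))
    (fun i => ⟨dy_nonneg _ _, dy_mono n (hu i)⟩) g

lemma core_of_local {s σ : ℝ} (hY : ∀ q, Measurable (Y q)) (h01 : ∀ q ω, Y q ω ∈ Icc (0:ℝ) 1)
    (hg : ∀ᵐ ω ∂P, GoodP (fun q => Y q ω)) (H : LocalMart s σ P Y)
    (f : ℝ → ℝ) (hf : ContDiff ℝ 2 f) (a b : ℝ) (ha : 0 ≤ a) (hab : a ≤ b) (ι : Type) [Fintype ι]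
    (u : ι → ℝ) (hu : ∀ i, u i ≤ a) (g : (ι → ℝ) →ᵇ ℝ) :
    ∫ ω, g (fun i => Xlim Y (u i) ω) *
      (f (Xlim Y b ω) - f (Xlim Y a ω) - ∫ v in Ioc a b, LWF s σ f (Xlim Y v ω)) ∂P = 0 := by
  have hm := Xlim_meas hY
  have hc := Xlim_cont Y
  have hr := Xlim_range h01
  have hLc := LWF_cont s σ f hf
  set G : Ω → ℝ := fun ω => g (fun i => Xlim Y (u i) ω) with hGdef
  have hG : Measurable G := g.continuous.measurable.comp (measurable_pi_lambda _ fun i => hm _)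
  have hGb : ∃ B, ∀ ω, |G ω| ≤ B := ⟨‖g‖, fun ω => g.norm_coe_le_norm _⟩
  have intG : ∀ ψ : ℝ → ℝ, Continuous ψ → ∀ t, Integrable (fun ω => G ω * ψ (Xlim Y t ω)) P := by
    intro ψ hψ t
    exact (integrable_path (P := P) hm hr ψ hψ t).bdd_mul hG.aestronglyMeasurable
      (ae_of_all _ fun ω => hGb.choose_spec ω)
  have intD : ∀ x y, Integrable (fun ω => G ω * f (Xlim Y y ω) - G ω * f (Xlim Y x ω)) P :=
    fun x y => (intG f hf.continuous y).sub (intG f hf.continuous x)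
  set F : ℝ → ℝ := fun t => ∫ ω, G ω * f (Xlim Y t ω) ∂P with hF
  set F' : ℝ → ℝ := fun t => ∫ ω, G ω * LWF s σ f (Xlim Y t ω) ∂P with hF'
  have cF : Continuous F := cont_expect hm hc hr f hf.continuous G hG hGb
  have cF' : Continuous F' := cont_expect hm hc hr _ hLc G hG hGb
  have split : ∀ x y : ℝ, ∫ ω, G ω * (f (Xlim Y y ω) - f (Xlim Y x ω)
        - (y - x) * LWF s σ f (Xlim Y x ω)) ∂P = F y - F x - (y - x) * F' x := by
    intro x y
    have e : (fun ω => G ω * (f (Xlim Y y ω) - f (Xlim Y x ω)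
        - (y - x) * LWF s σ f (Xlim Y x ω))) = fun ω => (G ω * f (Xlim Y y ω) - G ω * f (Xlim Y x ω))
        - (y - x) * (G ω * LWF s σ f (Xlim Y x ω)) := by ext ω; ring
    rw [e, integral_sub (intD x y) ((intG _ hLc x).const_mul _),
      integral_sub (intG f hf.continuous y) (intG f hf.continuous x), integral_const_mul]
  have hder : ∀ x ∈ Ioo a b, HasDerivWithinAt F (F' x) (Ioi x) x := by
    intro x hx
    rw [hasDerivWithinAt_iff_isLittleO, Asymptotics.isLittleO_iff]
    intro c hc0
    obtain ⟨δ, hδ, h⟩ := local_real (P := P) (s := s) (σ := σ) hY h01 hg H f hf (c / (‖g‖ + 1)) (by positivity)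
    have : ∀ᶠ y in 𝓝[>] x, y < x + δ := by
      filter_upwards [Ioo_mem_nhdsGT (show x < x + δ by linarith)] with y hy using hy.2
    filter_upwards [this, self_mem_nhdsWithin] with y hy1 hy2
    have hxy : x < y := hy2
    have := h x y (ha.trans hx.1.le) hxy.le (by linarith) ι u (fun i => (hu i).trans hx.1.le) g
    rw [split] at this
    simp only [smul_eq_mul, Real.norm_eq_abs]
    refine this.trans ?_
    rw [abs_of_pos (by linarith : 0 < y - x)]
    have h1 : c / (‖g‖ + 1) * ‖g‖ ≤ c := by
      rw [div_mul_eq_mul_div, div_le_iff₀ (by positivity)]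
      nlinarith [norm_nonneg g]
    nlinarith
  have ftc := intervalIntegral.integral_eq_sub_of_hasDeriv_right_of_le hab cF.continuousOn hder
    (cF'.intervalIntegrable _ _)
  rw [intervalIntegral.integral_of_le hab] at ftc
  have fub := fubini_path (P := P) hm hc hr _ hLc G hG hGb a b
  have e : (fun ω => G ω * (f (Xlim Y b ω) - f (Xlim Y a ω) - ∫ v in Ioc a b, LWF s σ f (Xlim Y v ω)))
      = fun ω => (G ω * f (Xlim Y b ω) - G ω * f (Xlim Y a ω)) - G ω * ∫ v in Ioc a b, LWF s σ f (Xlim Y v ω) := by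
    ext ω; ring
  have hI : Integrable (fun ω => ∫ v in Ioc a b, LWF s σ f (Xlim Y v ω)) P := by
    obtain ⟨C, hC0, hC⟩ := cont_bdd _ hLc
    refine Integrable.of_bound (meas_int hm hc _ hLc a b).aestronglyMeasurable (C * (b - a)) (ae_of_all _ fun ω => ?_)
    have := norm_setIntegral_le_of_norm_le_const (μ := volume) (s := Ioc a b) (C := C) (f := fun v => LWF s σ f (Xlim Y v ω)) (by simp)
      (fun v _ => hC _ (hr v ω))
    simpa [hab] using this
  rw [e, integral_sub (intD a b) (hI.bdd_mul hG.aestronglyMeasurable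
      (ae_of_all _ fun ω => hGb.choose_spec ω)),
    integral_sub (intG f hf.continuous b) (intG f hf.continuous a), fub]
  change F b - F a - ∫ v in Ioc a b, F' v = 0
  rw [ftc]; ring

lemma core_exists {s σ : ℝ} {μ₀ : Measure ℝ} (hY : ∀ q, Measurable (Y q)) (h01 : ∀ q ω, Y q ω ∈ Icc (0:ℝ) 1)
    (H1 : P.map (Y 0) = μ₀) (C : ℝ)
    (hC : ∀ p q : ℚ, 0 ≤ p → p ≤ q → ∫ ω, (Y q ω - Y p ω)^4 ∂P ≤ C * ((q - p : ℚ):ℝ)^2)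
    (H : LocalMart s σ P Y) : Nonempty (WFCore s σ μ₀) := by
  refine ⟨WFCore.mk Ω P inferInstance (Xlim Y) (Xlim_meas hY) (Xlim_cont Y) ?_ (Xlim_range h01) ?_ ?_⟩
  · intro t ht; rw [Xlim_nonpos Y ht, Xlim_nonpos Y le_rfl]
  · rw [Xlim_nonpos Y le_rfl, H1]
  · intro f hf a b ha hab I g
    exact core_of_local hY h01 (good_ae hY h01 C hC) H f hf a b ha hab I (fun i => i.1.1) (fun i => i.1.2) g
end transfer
end

section

abbrev UI : Type := unitInterval

/-- `Φ` depends only on the coordinates `≤ n`. -/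
def DepOn (n : ℕ) (Φ : (ℕ → UI) → ℝ) : Prop := ∀ w w' : ℕ → UI, (∀ k ≤ n, w k = w' k) → Φ w = Φ w'

def stepE (p u d : UI → UI) (n : ℕ) (Φ : (ℕ → UI) → ℝ) (w : ℕ → UI) : ℝ :=
  (p (w n) : ℝ) * Φ (Function.update w (n+1) (u (w n)))
    + (1 - (p (w n) : ℝ)) * Φ (Function.update w (n+1) (d (w n)))

structure IsWFChain (p u d : UI → UI) (α : Measure UI) (H : ℕ) (μ : Measure (ℕ → UI)) : Prop where
  prob : IsProbabilityMeasure μ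
  init : μ.map (fun w => w 0) = α
  step : ∀ n < H, ∀ Φ : (ℕ → UI) → ℝ, Measurable Φ → (∃ B, ∀ w, |Φ w| ≤ B) → DepOn (n+1) Φ →
    ∫ w, Φ w ∂μ = ∫ w, stepE p u d n Φ w ∂μ

lemma meas_upd (n : ℕ) : Measurable (fun z : (ℕ → UI) × UI => Function.update z.1 n z.2) := by
  rw [measurable_pi_iff]
  intro k
  by_cases h : k = n
  · subst h; simpa using measurable_snd
  · simp only [Function.update_of_ne h]
    exact (measurable_pi_apply k).comp measurable_fst

lemma stepE_meas {p u d : UI → UI} (hp : Measurable p) (hu : Measurable u) (hd : Measurable d) (n : ℕ)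
    {Φ : (ℕ → UI) → ℝ} (hΦ : Measurable Φ) : Measurable (stepE p u d n Φ) := by
  have hn : Measurable (fun w : ℕ → UI => w n) := measurable_pi_apply n
  have hpn : Measurable (fun w : ℕ → UI => ((p (w n) : UI) : ℝ)) := measurable_subtype_coe.comp (hp.comp hn)
  have h1 : ∀ v : UI → UI, Measurable v → Measurable (fun w : ℕ → UI => Φ (Function.update w (n+1) (v (w n)))) :=
    fun v hv => hΦ.comp ((meas_upd (n+1)).comp (measurable_id.prodMk (hv.comp hn)))
  unfold stepE
  exact (hpn.mul (h1 u hu)).add ((measurable_const.sub hpn).mul (h1 d hd))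

lemma stepE_dep {p u d : UI → UI} {n : ℕ} {Φ : (ℕ → UI) → ℝ} (h : DepOn (n+1) Φ) : DepOn n (stepE p u d n Φ) := by
  intro w w' hw
  unfold stepE
  rw [hw n le_rfl]
  have : ∀ z, Φ (Function.update w (n+1) z) = Φ (Function.update w' (n+1) z) := by
    intro z
    apply h
    intro k hk
    by_cases hkn : k = n+1
    · subst hkn; simp
    · rw [Function.update_of_ne hkn, Function.update_of_ne hkn]; exact hw k (by omega)
  rw [this, this]

lemma DepOn.mono {n m : ℕ} (hnm : n ≤ m) {Φ : (ℕ → UI) → ℝ} (h : DepOn n Φ) : DepOn m Φ :=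
  fun w w' hw => h w w' fun k hk => hw k (hk.trans hnm)

lemma int_coin (p : UI) (A B : ℝ) : ∫ v : UI, (if v ≤ p then A else B) = (p:ℝ) * A + (1 - (p:ℝ)) * B := by
  have h : (fun v : UI => if v ≤ p then A else B) = fun v => (Iic p).indicator (fun _ => A - B) v + B := by
    ext v; by_cases h : v ≤ p <;> simp [h]
  rw [h, integral_add ((integrable_const _).indicator measurableSet_Iic) (integrable_const _),
    integral_indicator_const _ measurableSet_Iic]
  simp [measureReal_def]
  rw [ENNReal.toReal_ofReal p.2.1]; ring

lemma chain_exists {p u d : UI → UI} (hp : Measurable p) (hu : Measurable u) (hd : Measurable d)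
    (α : Measure UI) [IsProbabilityMeasure α] (H : ℕ) : ∃ μ, IsWFChain p u d α H μ := by
  induction H with
  | zero =>
    have hm : Measurable (fun (x : UI) (_ : ℕ) => x) := measurable_pi_lambda _ fun _ => measurable_id
    refine ⟨α.map (fun x _ => x), ⟨Measure.isProbabilityMeasure_map hm.aemeasurable, ?_, fun n hn => by omega⟩⟩
    rw [Measure.map_map (measurable_pi_apply 0) hm]
    exact Measure.map_id
  | succ H ih =>
    obtain ⟨μ, hμ⟩ := ih
    have := hμ.prob
    let θ : (ℕ → UI) × UI → (ℕ → UI) := fun z =>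
      Function.update z.1 (H+1) (if z.2 ≤ p (z.1 H) then u (z.1 H) else d (z.1 H))
    have hn : Measurable (fun z : (ℕ → UI) × UI => z.1 H) := (measurable_pi_apply H).comp measurable_fst
    have hθ : Measurable θ := by
      refine (meas_upd (H+1)).comp (measurable_fst.prodMk ?_)
      exact Measurable.ite (measurableSet_le measurable_snd (hp.comp hn)) (hu.comp hn) (hd.comp hn)
    have hup : ∀ (w : ℕ → UI) (z : UI) k, k ≤ H → Function.update w (H+1) z k = w k := by
      intro w z k hk; rw [Function.update_of_ne (by omega)]
    have old : ∀ Φ : (ℕ → UI) → ℝ, Measurable Φ → DepOn H Φ →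
        ∫ w, Φ w ∂((μ.prod volume).map θ) = ∫ w, Φ w ∂μ := by
      intro Φ hΦ hdep
      rw [integral_map hθ.aemeasurable hΦ.aestronglyMeasurable]
      have : ∀ z : (ℕ → UI) × UI, Φ (θ z) = Φ z.1 := fun z => hdep _ _ fun k hk => hup _ _ k hk
      simp_rw [this]
      rw [integral_fun_fst]; simp
    refine ⟨(μ.prod volume).map θ, ⟨Measure.isProbabilityMeasure_map hθ.aemeasurable, ?_, ?_⟩⟩
    · rw [Measure.map_map (measurable_pi_apply 0) hθ]
      have : (fun w : ℕ → UI => w 0) ∘ θ = (fun w : ℕ → UI => w 0) ∘ Prod.fst := by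
        ext z; simp only [Function.comp, θ]; rw [hup _ _ 0 (by omega)]
      rw [this, ← Measure.map_map (measurable_pi_apply 0) measurable_fst, Measure.map_fst_prod]
      simpa using hμ.init
    · intro n hnH Φ hΦ hB hdep
      rcases Nat.lt_succ_iff_lt_or_eq.1 hnH with hlt | rfl
      · rw [old Φ hΦ (hdep.mono (by omega)), old _ (stepE_meas hp hu hd n hΦ) ((stepE_dep hdep).mono (by omega))]
        exact hμ.step n hlt Φ hΦ hB hdep
      · rw [old _ (stepE_meas hp hu hd n hΦ) (stepE_dep hdep)]
        obtain ⟨B, hB⟩ := hB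
        rw [integral_map hθ.aemeasurable hΦ.aestronglyMeasurable, integral_prod]
        · refine integral_congr_ae (ae_of_all _ fun w => ?_)
          simp only [θ, stepE]
          rw [← int_coin]
          refine integral_congr_ae (ae_of_all _ fun v => ?_)
          simp only
          split_ifs <;> rfl
        · exact Integrable.of_bound (hΦ.comp hθ).aestronglyMeasurable B (ae_of_all _ fun z => hB _)

/-! moments -/
section mom
variable {p u d : UI → UI} {α : Measure UI} {H : ℕ} {μ : Measure (ℕ → UI)} {s κ h : ℝ}

structure StepB (p u d : UI → UI) (s κ h : ℝ) : Prop where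
  mp : Measurable p
  mu : Measurable u
  md : Measurable d
  hs : 0 ≤ s
  hκ : 0 ≤ κ
  hh : 0 ≤ h
  mean : ∀ x : UI, |(p x : ℝ) * ((u x : ℝ) - x) + (1 - (p x : ℝ)) * ((d x : ℝ) - x)| ≤ s * h
  squ : ∀ x : UI, ((u x : ℝ) - x)^2 ≤ κ * h
  sqd : ∀ x : UI, ((d x : ℝ) - x)^2 ≤ κ * h

lemma int_bdd {Ω : Type*} [MeasurableSpace Ω] {μ : Measure Ω} [IsProbabilityMeasure μ] {Φ : Ω → ℝ} (hm : Measurable Φ) (B : ℝ) (hB : ∀ w, |Φ w| ≤ B) :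
    Integrable Φ μ := Integrable.of_bound hm.aestronglyMeasurable B (ae_of_all _ hB)

lemma abs_le_one_sub (a b : UI) : |(a:ℝ) - b| ≤ 1 := by
  have h1 := a.2; have h2 := b.2
  exact abs_sub_le_iff.2 ⟨by linarith [h1.2, h2.1], by linarith [h2.2, h1.1]⟩

lemma mx (k : ℕ) : Measurable (fun w : ℕ → UI => ((w k : UI) : ℝ)) :=
  measurable_subtype_coe.comp (measurable_pi_apply k)

lemma mom2 (hb : StepB p u d s κ h) (hc : IsWFChain p u d α H μ) (J j : ℕ) (hj : J + j ≤ H) :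
    ∫ w, ((w (J+j) : ℝ) - w J)^2 ∂μ ≤ (2*s+κ) * h * j := by
  have := hc.prob
  obtain ⟨_, _, _, hs, hκ, hh, hmean, hsu, hsd⟩ := hb
  induction j with
  | zero => simp
  | succ j ih =>
    have ih := ih (by omega)
    have bd : ∀ a b : UI, |((a:ℝ) - b)^2| ≤ 1 := fun a b => by
      rw [abs_pow]; exact pow_le_one₀ (abs_nonneg _) (abs_le_one_sub a b)
    have mm : ∀ k, Measurable (fun w : ℕ → UI => ((w k : ℝ) - w J)^2) := fun k =>
      ((mx k).sub (mx J)).pow_const 2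
    have st := hc.step (J+j) (by omega) (fun w => ((w (J+j+1) : ℝ) - w J)^2) (mm _) ⟨1, fun w => bd _ _⟩
      (fun w w' hw => by simp only; rw [hw _ le_rfl, hw J (by omega)])
    rw [← Nat.add_assoc, st]
    have i1 : Integrable (fun w : ℕ → UI => ((w (J+j) : ℝ) - w J)^2) μ := int_bdd (mm _) 1 fun w => bd _ _
    have le : ∫ w, stepE p u d (J+j) (fun w => ((w (J+j+1) : ℝ) - w J)^2) w ∂μ
        ≤ ∫ w, (((w (J+j) : ℝ) - w J)^2 + (2*s+κ)*h) ∂μ := by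
      refine integral_mono_of_nonneg (ae_of_all _ fun w => ?_) (i1.add (integrable_const _)) (ae_of_all _ fun w => ?_)
      · simp only [stepE]
        have := (p (w (J+j))).2
        exact add_nonneg (mul_nonneg this.1 (sq_nonneg _)) (mul_nonneg (by linarith [this.2]) (sq_nonneg _))
      · simp only [stepE]
        rw [Function.update_self, Function.update_self, Function.update_of_ne (by omega), Function.update_of_ne (by omega)]
        have hx := abs_le.1 (hmean (w (J+j)))
        have h1 := hsu (w (J+j))
        have h2 := hsd (w (J+j))
        have hp := (p (w (J+j))).2
        have hD := abs_le.1 (abs_le_one_sub (w (J+j)) (w J))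
        generalize ((p (w (J+j)) : UI):ℝ) = P at *
        generalize ((u (w (J+j)) : UI):ℝ) = U at *
        generalize ((d (w (J+j)) : UI):ℝ) = D at *
        generalize ((w (J+j) : UI):ℝ) = x at *
        generalize ((w J : UI):ℝ) = y at *
        have e1 : P * (U-x)^2 ≤ P * (κ*h) := mul_le_mul_of_nonneg_left h1 hp.1
        have e2 : (1-P) * (D-x)^2 ≤ (1-P) * (κ*h) := mul_le_mul_of_nonneg_left h2 (by linarith [hp.2])
        have e3 : (x - y) * (P*(U-x)+(1-P)*(D-x)) ≤ s*h := by
          have h0 : 0 ≤ s * h := mul_nonneg hs hh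
          refine (le_abs_self _).trans ?_
          rw [abs_mul]
          have := mul_le_mul (abs_le.2 hD) (abs_le.2 hx) (abs_nonneg _) zero_le_one
          linarith
        nlinarith
    refine le.trans ?_
    rw [integral_add i1 (integrable_const _), integral_const]
    simp only [probReal_univ, one_smul]
    push_cast; linarith

lemma mom4 (hb : StepB p u d s κ h) (hc : IsWFChain p u d α H μ) (J j : ℕ) (hj : J + j ≤ H) :
    ∫ w, ((w (J+j) : ℝ) - w J)^4 ∂μ ≤ ((4*s+8*κ)*(2*s+κ) + 3*κ^2) * (h * j)^2 := by
  have hb0 := hb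
  have := hc.prob
  obtain ⟨_, _, _, hs, hκ, hh, hmean, hsu, hsd⟩ := hb
  induction j with
  | zero => simp
  | succ j ih =>
    have ih := ih (by omega)
    have bd : ∀ (n : ℕ) (a b : UI), |((a:ℝ) - b)^n| ≤ 1 := fun n a b => by
      rw [abs_pow]; exact pow_le_one₀ (abs_nonneg _) (abs_le_one_sub a b)
    have mm : ∀ n k, Measurable (fun w : ℕ → UI => ((w k : ℝ) - w J)^n) := fun n k =>
      ((mx k).sub (mx J)).pow_const n
    have st := hc.step (J+j) (by omega) (fun w => ((w (J+j+1) : ℝ) - w J)^4) (mm _ _) ⟨1, fun w => bd _ _ _⟩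
      (fun w w' hw => by simp only; rw [hw _ le_rfl, hw J (by omega)])
    rw [← Nat.add_assoc, st]
    have i1 : Integrable (fun w : ℕ → UI => ((w (J+j) : ℝ) - w J)^4) μ := int_bdd (mm _ _) 1 fun w => bd _ _ _
    have i2 : Integrable (fun w : ℕ → UI => ((w (J+j) : ℝ) - w J)^2) μ := int_bdd (mm _ _) 1 fun w => bd _ _ _
    have i3 : Integrable (fun w : ℕ → UI => ((w (J+j) : ℝ) - w J)^4 + (4*s+8*κ)*h * ((w (J+j) : ℝ) - w J)^2) μ :=
      i1.add (i2.const_mul _)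
    have le : ∫ w, stepE p u d (J+j) (fun w => ((w (J+j+1) : ℝ) - w J)^4) w ∂μ
        ≤ ∫ w, (((w (J+j) : ℝ) - w J)^4 + (4*s+8*κ)*h * ((w (J+j) : ℝ) - w J)^2 + 3 * κ^2 * h^2) ∂μ := by
      refine integral_mono_of_nonneg (ae_of_all _ fun w => ?_) (i3.add (integrable_const _)) (ae_of_all _ fun w => ?_)
      · simp only [stepE]
        have := (p (w (J+j))).2
        exact add_nonneg (mul_nonneg this.1 (by positivity)) (mul_nonneg (by linarith [this.2]) (by positivity))
      · simp only [stepE]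
        rw [Function.update_self, Function.update_self, Function.update_of_ne (by omega), Function.update_of_ne (by omega)]
        have hx := abs_le.1 (hmean (w (J+j)))
        have h1 := hsu (w (J+j))
        have h2 := hsd (w (J+j))
        have hp := (p (w (J+j))).2
        have hD := (abs_le_one_sub (w (J+j)) (w J))
        generalize ((p (w (J+j)) : UI):ℝ) = P at *
        generalize ((u (w (J+j)) : UI):ℝ) = U at *
        generalize ((d (w (J+j)) : UI):ℝ) = D at *
        generalize ((w (J+j) : UI):ℝ) = x at *
        generalize ((w J : UI):ℝ) = y at *
        have key : ∀ z : ℝ, (z - x)^2 ≤ κ*h → (z - y)^4 ≤ (x-y)^4 + 4*(x-y)^3*(z-x) + 8*(x-y)^2*(κ*h) + 3*(κ*h)^2 := by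
          intro z hz
          have a1 : ((z-x)^2)^2 ≤ (κ*h)^2 := pow_le_pow_left₀ (sq_nonneg _) hz 2
          have a2 : (x-y)^2 * (z-x)^2 ≤ (x-y)^2*(κ*h) := mul_le_mul_of_nonneg_left hz (sq_nonneg _)
          have a3 : 0 ≤ (z-x)^2 * ((x-y) - (z-x))^2 := by positivity
          nlinarith
        have e1 := mul_le_mul_of_nonneg_left (key U h1) hp.1
        have e2 := mul_le_mul_of_nonneg_left (key D h2) (show 0 ≤ 1 - P by linarith [hp.2])
        have e3 : (x - y)^3 * (P*(U-x)+(1-P)*(D-x)) ≤ s*h * (x-y)^2 := by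
          refine (le_abs_self _).trans ?_
          rw [abs_mul, abs_pow]
          have c1 : |x-y|^3 ≤ (x-y)^2 := by
            rw [← sq_abs (x-y)]
            nlinarith [abs_nonneg (x-y), mul_nonneg (sq_nonneg |x-y|) (sub_nonneg.2 hD)]
          have := mul_le_mul c1 (abs_le.2 hx) (abs_nonneg _) (sq_nonneg _)
          linarith
        nlinarith
    refine le.trans ?_
    rw [integral_add i3 (integrable_const _), integral_add i1 (i2.const_mul _), integral_const_mul, integral_const]
    simp only [probReal_univ, one_smul]
    have m2 := mom2 hb0 hc J j (by omega)
    have m3 := mul_le_mul_of_nonneg_left m2 (show 0 ≤ (4*s+8*κ)*h by positivity)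
    have q1 : 0 ≤ (4*s+8*κ)*(2*s+κ)*h^2*j := by positivity
    have q2 : 0 ≤ (4*s+8*κ)*(2*s+κ)*h^2 := by positivity
    have q3 : 0 ≤ κ^2*h^2*j := by positivity
    push_cast; nlinarith
end mom
end

section
section gen2
variable {p u d : UI → UI} {α : Measure UI} {H : ℕ} {μ : Measure (ℕ → UI)} {s κ h : ℝ}

lemma gen_est (hb : StepB p u d s κ h) (hc : IsWFChain p u d α H μ) (f ψ : ℝ → ℝ) (hf : Continuous f)
    (hψ : Continuous ψ) (e ε Ce : ℝ) (he : 0 ≤ e) (hε : 0 ≤ ε) (hCe : 0 ≤ Ce)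
    (hgen : ∀ x : UI, |(p x : ℝ) * f (u x) + (1 - (p x : ℝ)) * f (d x) - f x - h * ψ x| ≤ h * e)
    (hmod : ∀ a b : UI, |ψ a - ψ b| ≤ ε + Ce * ((a:ℝ) - b)^2)
    (J : ℕ) (G : (ℕ → UI) → ℝ) (hG : Measurable G) (B : ℝ) (hB0 : 0 ≤ B) (hB : ∀ w, |G w| ≤ B) (hdep : DepOn J G)
    (j : ℕ) (hj : J + j ≤ H) :
    |∫ w, G w * (f (w (J+j)) - f (w J) - (j * h) * ψ (w J)) ∂μ|
      ≤ B * (j * h) * (e + ε + Ce * ((2*s+κ) * (h*j))) := by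
  have := hc.prob
  have hs := hb.hs
  have hκ := hb.hκ
  have hh := hb.hh
  obtain ⟨Cf, hCf0, hCf⟩ := cont_bdd f hf
  obtain ⟨Cp, hCp0, hCp⟩ := cont_bdd ψ hψ
  have mf : ∀ k, Measurable (fun w : ℕ → UI => f (w k)) := fun k => hf.measurable.comp (mx k)
  have mψ : ∀ k, Measurable (fun w : ℕ → UI => ψ (w k)) := fun k => hψ.measurable.comp (mx k)
  have mΦ : ∀ (k : ℕ) (t : ℝ), Measurable (fun w : ℕ → UI => G w * (f (w k) - f (w J) - t * ψ (w J))) :=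
    fun k t => hG.mul (((mf k).sub (mf J)).sub ((mψ J).const_mul t))
  have bΦ : ∀ (k : ℕ) (t : ℝ), ∀ w : ℕ → UI, |G w * (f (w k) - f (w J) - t * ψ (w J))| ≤ B * (Cf + Cf + |t| * Cp) := by
    intro k t w
    rw [abs_mul]
    refine mul_le_mul (hB w) ?_ (abs_nonneg _) hB0
    refine (abs_sub _ _).trans (add_le_add ((abs_sub _ _).trans (add_le_add (hCf _ (w k).2) (hCf _ (w J).2))) ?_)
    rw [abs_mul]; exact mul_le_mul_of_nonneg_left (hCp _ (w J).2) (abs_nonneg _)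
  induction j with
  | zero => simp
  | succ j ih =>
    have ih := ih (by omega)
    have st := hc.step (J+j) (by omega) _ (mΦ (J+j+1) ((j+1:ℕ)*h)) ⟨_, bΦ (J+j+1) ((j+1:ℕ)*h)⟩
      (fun w w' hw => by
        rw [hw _ le_rfl, hw J (by omega), hdep w w' fun k hk => hw k (by omega)])
    rw [← Nat.add_assoc, st]
    set A : (ℕ → UI) → ℝ := fun w => G w * (f (w (J+j)) - f (w J) - (j * h) * ψ (w J)) with hA
    set R : (ℕ → UI) → ℝ := stepE p u d (J+j) (fun w => G w * (f (w (J+j+1)) - f (w J) - ((j+1:ℕ) * h) * ψ (w J))) - A with hR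
    have iA : Integrable A μ := int_bdd (mΦ _ _) _ (bΦ _ _)
    have Rb : ∀ w, |R w| ≤ B * h * (e + ε) + B * h * Ce * ((w (J+j) : ℝ) - w J)^2 := by
      intro w
      have hdu : ∀ z, G (Function.update w (J+j+1) z) = G w := fun z =>
        hdep _ _ fun k hk => Function.update_of_ne (by omega) _ _
      have eR : R w = G w * (((p (w (J+j)) : ℝ) * f (u (w (J+j))) + (1 - (p (w (J+j)) : ℝ)) * f (d (w (J+j)))
          - f (w (J+j)) - h * ψ (w (J+j))) + h * (ψ (w (J+j)) - ψ (w J))) := by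
        simp only [hR, hA, Pi.sub_apply, stepE, hdu]
        rw [Function.update_self, Function.update_self, Function.update_of_ne (by omega), Function.update_of_ne (by omega)]
        push_cast; ring
      rw [eR, abs_mul]
      have t : |((p (w (J+j)) : ℝ) * f (u (w (J+j))) + (1 - (p (w (J+j)) : ℝ)) * f (d (w (J+j)))
          - f (w (J+j)) - h * ψ (w (J+j))) + h * (ψ (w (J+j)) - ψ (w J))| ≤ h * e + h * (ε + Ce * ((w (J+j) : ℝ) - w J)^2) := by
        refine (abs_add_le _ _).trans (add_le_add (hgen _) ?_)
        rw [abs_mul, abs_of_nonneg hh]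
        exact mul_le_mul_of_nonneg_left (hmod _ _) hh
      refine (mul_le_mul (hB w) t (abs_nonneg _) hB0).trans (le_of_eq ?_)
      ring
    have mR : Measurable R := (stepE_meas hb.mp hb.mu hb.md _ (mΦ _ _)).sub (mΦ _ _)
    have i2 : Integrable (fun w : ℕ → UI => ((w (J+j) : ℝ) - w J)^2) μ := by
      refine int_bdd (((mx _).sub (mx J)).pow_const 2) 1 fun w => ?_
      rw [abs_pow]; exact pow_le_one₀ (abs_nonneg _) (abs_le_one_sub _ _)
    have i3 : Integrable (fun w : ℕ → UI => B * h * (e + ε) + B * h * Ce * ((w (J+j) : ℝ) - w J)^2) μ :=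
      (integrable_const _).add (i2.const_mul _)
    have iR : Integrable R μ :=
      (i3.mono' mR.aestronglyMeasurable (ae_of_all _ Rb))
    have e1 : ∫ w, stepE p u d (J+j) (fun w => G w * (f (w (J+j+1)) - f (w J) - ((j+1:ℕ) * h) * ψ (w J))) w ∂μ
        = ∫ w, A w ∂μ + ∫ w, R w ∂μ := by
      rw [← integral_add iA iR]
      refine integral_congr_ae (ae_of_all _ fun w => ?_)
      simp [hR]
    have hRi : |∫ w, R w ∂μ| ≤ B * h * (e + ε) + B * h * Ce * ((2*s+κ) * h * j) := by
      refine (abs_integral_le_integral_abs).trans ?_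
      refine (integral_mono_of_nonneg (ae_of_all _ fun w => abs_nonneg _)
        i3 (ae_of_all _ Rb)).trans ?_
      rw [integral_add (integrable_const _) (i2.const_mul _), integral_const, integral_const_mul]
      simp only [probReal_univ, one_smul]
      have := mom2 hb hc J j (by omega)
      gcongr
    rw [e1]
    refine (abs_add_le _ _).trans ((add_le_add ih hRi).trans ?_)
    have q1 : 0 ≤ B * h * Ce * ((2*s+κ) * h) := by positivity
    have q2 : 0 ≤ B * h * Ce * ((2*s+κ) * h) * j := by positivity
    push_cast
    nlinarith
end gen2
end

section

lemma unif01 (ψ : ℝ → ℝ) (hψ : Continuous ψ) (ε : ℝ) (hε : 0 < ε) :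
    ∃ δ, 0 < δ ∧ ∀ a ∈ Icc (0:ℝ) 1, ∀ b ∈ Icc (0:ℝ) 1, |a - b| < δ → |ψ a - ψ b| < ε := by
  have := isCompact_Icc.uniformContinuousOn_of_continuous (hψ.continuousOn (s := Icc (0:ℝ) 1))
  rw [Metric.uniformContinuousOn_iff] at this
  exact this ε hε

lemma mod01 (ψ : ℝ → ℝ) (hψ : Continuous ψ) (ε : ℝ) (hε : 0 < ε) :
    ∃ Ce, 0 ≤ Ce ∧ ∀ a b : UI, |ψ a - ψ b| ≤ ε + Ce * ((a:ℝ) - b)^2 := by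
  obtain ⟨δ, hδ, h⟩ := unif01 ψ hψ ε hε
  obtain ⟨C, hC0, hC⟩ := cont_bdd ψ hψ
  refine ⟨2 * C / δ^2, by positivity, fun a b => ?_⟩
  by_cases hab : |(a:ℝ) - b| < δ
  · have := h a a.2 b b.2 hab
    have h2 : 0 ≤ 2 * C / δ^2 * ((a:ℝ) - b)^2 := by positivity
    linarith
  · push Not at hab
    have h1 : |ψ a - ψ b| ≤ C + C := (abs_sub _ _).trans (add_le_add (hC _ a.2) (hC _ b.2))
    have h2 : δ^2 ≤ ((a:ℝ) - b)^2 := by rw [← sq_abs ((a:ℝ) - b)]; gcongr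
    have h3 : 2 * C ≤ 2 * C / δ^2 * ((a:ℝ) - b)^2 := by
      rw [div_mul_eq_mul_div, le_div_iff₀ (by positivity)]
      exact mul_le_mul_of_nonneg_left h2 (by positivity)
    linarith

lemma taylor2 (f : ℝ → ℝ) (hf : ContDiff ℝ 2 f) (η : ℝ) (hη : 0 < η) :
    ∃ δ, 0 < δ ∧ ∀ x ∈ Icc (0:ℝ) 1, ∀ y ∈ Icc (0:ℝ) 1, |y - x| < δ →
      |f y - f x - deriv f x * (y - x) - deriv (deriv f) x / 2 * (y - x)^2| ≤ η * (y-x)^2 := by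
  have hf1 : Differentiable ℝ f := hf.differentiable (by norm_num)
  have h1 : ContDiff ℝ 1 (deriv f) := by
    have : ContDiff ℝ (1+1) f := by simpa [one_add_one_eq_two] using hf
    exact (contDiff_succ_iff_deriv.1 this).2.2
  have hf2 : Differentiable ℝ (deriv f) := h1.differentiable (by norm_num)
  have hc2 : Continuous (deriv (deriv f)) := h1.continuous_deriv (by norm_num)
  obtain ⟨δ, hδ, h⟩ := unif01 _ hc2 η hη
  refine ⟨δ, hδ, fun x hx y hy hxy => ?_⟩
  have hsub : uIcc x y ⊆ Icc 0 1 := uIcc_subset_Icc hx hy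
  have hdist : ∀ z ∈ uIcc x y, |z - x| ≤ |y - x| := fun z hz => abs_sub_left_of_mem_uIcc hz
  have hx' : x ∈ uIcc x y := left_mem_uIcc
  have hy' : y ∈ uIcc x y := right_mem_uIcc
  have step1 : ∀ z ∈ uIcc x y, |deriv f z - deriv f x - deriv (deriv f) x * (z - x)| ≤ η * |y - x| := by
    intro z hz
    have hd : ∀ v ∈ uIcc x y, HasDerivWithinAt (fun v => deriv f v - deriv (deriv f) x * (v - x))
        (deriv (deriv f) v - deriv (deriv f) x) (uIcc x y) v := by
      intro v _
      have := ((hf2 v).hasDerivAt.sub (((hasDerivAt_id v).sub_const x).const_mul (deriv (deriv f) x))).hasDerivWithinAt (s := uIcc x y)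
      rw [mul_one] at this
      exact this
    have := (convex_uIcc x y).norm_image_sub_le_of_norm_hasDerivWithin_le hd (C := η)
      (fun v hv => (h v (hsub hv) x hx ((hdist v hv).trans_lt hxy)).le) hx' hz
    simp only [Real.norm_eq_abs, sub_self, mul_zero, sub_zero] at this
    have e : deriv f z - deriv f x - deriv (deriv f) x * (z - x) = deriv f z - deriv (deriv f) x * (z - x) - deriv f x := by ring
    rw [e]
    exact this.trans (mul_le_mul_of_nonneg_left (hdist z hz) hη.le)
  have hd : ∀ v ∈ uIcc x y, HasDerivWithinAt (fun v => f v - deriv f x * (v - x) - deriv (deriv f) x / 2 * (v - x)^2)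
        (deriv f v - deriv f x - deriv (deriv f) x * (v - x)) (uIcc x y) v := by
    intro v _
    have a1 := ((hasDerivAt_id v).sub_const x).const_mul (deriv f x)
    have a2 := (((hasDerivAt_id v).sub_const x).pow 2).const_mul (deriv (deriv f) x / 2)
    have := (((hf1 v).hasDerivAt.sub a1).sub a2).hasDerivWithinAt (s := uIcc x y)
    refine this.congr_deriv ?_
    simp only [id]; ring
  have := (convex_uIcc x y).norm_image_sub_le_of_norm_hasDerivWithin_le hd (C := η * |y-x|) step1 hx' hy'
  simp only [Real.norm_eq_abs, sub_self, mul_zero, sub_zero] at this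
  have e : f y - f x - deriv f x * (y - x) - deriv (deriv f) x / 2 * (y - x)^2
    = f y - deriv f x * (y - x) - deriv (deriv f) x / 2 * (y - x)^2 - (f x - deriv (deriv f) x / 2 * 0^2) := by ring
  rw [e]
  refine this.trans (le_of_eq ?_)
  rw [mul_assoc, abs_mul_abs_self, sq]

def stm (s h x : ℝ) : ℝ := x - s * h * (x * (1 - x))
def stp (s h : ℝ) (x : UI) : UI := projIcc 0 1 zero_le_one (stm s h x)
def stu (s σ h : ℝ) (x : UI) : UI := projIcc 0 1 zero_le_one ((1 - σ * √h) * stm s h x + σ * √h)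
def std (s σ h : ℝ) (x : UI) : UI := projIcc 0 1 zero_le_one ((1 - σ * √h) * stm s h x)

structure HOK (s σ h : ℝ) : Prop where
  s0 : 0 ≤ s
  σ0 : 0 < σ
  h0 : 0 < h
  h1 : h ≤ 1
  sh : s * h ≤ 1
  σh : σ * √h ≤ 1

variable {s σ h : ℝ}

lemma stm_mem (k : HOK s σ h) (x : UI) : stm s h x ∈ Icc (0:ℝ) 1 := by
  obtain ⟨x, hx⟩ := x
  have h2 : 0 ≤ x * (1-x) := mul_nonneg hx.1 (by linarith [hx.2])
  have h3 : 0 ≤ s * h := mul_nonneg k.s0 k.h0.le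
  simp only [stm, mem_Icc]
  have := k.sh
  constructor
  · nlinarith [sq_nonneg x]
  · nlinarith [hx.2]

lemma stp_coe (k : HOK s σ h) (x : UI) : (stp s h x : ℝ) = stm s h x := by
  unfold stp; rw [projIcc_of_mem _ (stm_mem k x)]

lemma stu_coe (k : HOK s σ h) (x : UI) : (stu s σ h x : ℝ) = (1 - σ * √h) * stm s h x + σ * √h := by
  have hm := stm_mem k x
  have h1 := k.σh
  have h0 : 0 ≤ σ * √h := mul_nonneg k.σ0.le (Real.sqrt_nonneg _)
  unfold stu; rw [projIcc_of_mem]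
  exact ⟨by nlinarith [hm.1, hm.2], by nlinarith [hm.1, hm.2]⟩

lemma std_coe (k : HOK s σ h) (x : UI) : (std s σ h x : ℝ) = (1 - σ * √h) * stm s h x := by
  have hm := stm_mem k x
  have h1 := k.σh
  have h0 : 0 ≤ σ * √h := mul_nonneg k.σ0.le (Real.sqrt_nonneg _)
  unfold std; rw [projIcc_of_mem]
  exact ⟨by nlinarith [hm.1, hm.2], by nlinarith [hm.1, hm.2]⟩

lemma stepB_ok (k : HOK s σ h) : StepB (stp s h) (stu s σ h) (std s σ h) s ((s+σ)^2) h := by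
  have hcm : Continuous (fun x : UI => stm s h x) := by unfold stm; fun_prop
  have hsq : √h ^ 2 = h := Real.sq_sqrt k.h0.le
  have hs1 : h ≤ √h := by
    have : √h ≤ 1 := Real.sqrt_le_one.2 k.h1
    nlinarith [Real.sqrt_nonneg h]
  have aux : ∀ (x : UI) (z c : ℝ), 0 ≤ c → c ≤ 1 → (z = stm s h x - x + σ * √h * c ∨ z = stm s h x - x - σ * √h * c) →
      z^2 ≤ (s+σ)^2 * h := by
    intro x z c hc0 hc1 hz
    obtain ⟨x, hx⟩ := x
    have h2 : 0 ≤ x * (1-x) := mul_nonneg hx.1 (by linarith [hx.2])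
    have h3 : x * (1-x) ≤ 1 := by nlinarith [hx.1, hx.2]
    have hs0 := k.s0
    have hr := Real.sqrt_nonneg h
    have hσ0 := k.σ0
    have a1 : s * h * (x*(1-x)) ≤ s * √h := by
      calc s * h * (x*(1-x)) ≤ s * √h * 1 := by
            gcongr
        _ = _ := by ring
    have a2 : 0 ≤ s * h * (x*(1-x)) := by have := k.h0; positivity
    have a3 : σ * √h * c ≤ σ * √h := mul_le_of_le_one_right (by positivity) hc1
    have a4 : 0 ≤ σ * √h * c := by positivity
    have : |z| ≤ (s+σ) * √h := by
      rw [abs_le]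
      simp only [stm] at hz
      rcases hz with hz | hz <;> rw [hz] <;> constructor <;> nlinarith
    calc z^2 = |z|^2 := (sq_abs z).symm
      _ ≤ ((s+σ) * √h)^2 := by gcongr
      _ = _ := by rw [mul_pow, hsq]
  refine ⟨?_, ?_, ?_, k.s0, sq_nonneg _, k.h0.le, ?_, ?_, ?_⟩
  · exact (continuous_projIcc.comp hcm).measurable
  · exact (continuous_projIcc.comp (f := fun x : UI => (1 - σ * √h) * stm s h x + σ * √h) (by fun_prop)).measurable
  · exact (continuous_projIcc.comp (f := fun x : UI => (1 - σ * √h) * stm s h x) (by fun_prop)).measurable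
  · intro x
    rw [stp_coe k, stu_coe k, std_coe k]
    have e : stm s h x * ((1 - σ * √h) * stm s h x + σ * √h - x) + (1 - stm s h x) * ((1 - σ * √h) * stm s h x - x)
      = -(s * h * ((x:ℝ) * (1 - x))) := by simp only [stm]; ring
    rw [e, abs_neg]
    have hx := x.2
    have h2 : 0 ≤ (x:ℝ) * (1-x) := mul_nonneg hx.1 (by linarith [hx.2])
    have h3 : (x:ℝ) * (1-x) ≤ 1 := by nlinarith [hx.1, hx.2]
    have h4 : 0 ≤ s * h := mul_nonneg k.s0 k.h0.le
    rw [abs_of_nonneg (by positivity)]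
    exact mul_le_of_le_one_right h4 h3
  · intro x
    have hm := stm_mem k x
    rw [stu_coe k]
    exact aux x _ (1 - stm s h x) (by linarith [hm.2]) (by linarith [hm.1]) (Or.inl (by ring))
  · intro x
    have hm := stm_mem k x
    rw [std_coe k]
    exact aux x _ (stm s h x) hm.1 hm.2 (Or.inr (by ring))

set_option maxHeartbeats 1000000 in
lemma gen_conv (s σ : ℝ) (f : ℝ → ℝ) (hf : ContDiff ℝ 2 f) (e : ℝ) (he : 0 < e) :
    ∃ h0, 0 < h0 ∧ ∀ h, h ≤ h0 → HOK s σ h → ∀ x : UI,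
      |(stp s h x : ℝ) * f (stu s σ h x) + (1 - (stp s h x : ℝ)) * f (std s σ h x) - f x - h * LWF s σ f x| ≤ h * e := by
  have hc2 : Continuous (deriv (deriv f)) := by
    have : ContDiff ℝ (1+1) f := by simpa [one_add_one_eq_two] using hf
    exact (contDiff_succ_iff_deriv.1 this).2.2.continuous_deriv (by norm_num)
  obtain ⟨C2, hC20, hC2⟩ := cont_bdd _ hc2
  set κ := (s+σ)^2 with hκ
  have hκ0 : 0 ≤ κ := sq_nonneg _
  obtain ⟨δ, hδ, ht⟩ := taylor2 f hf (e / (2 * (κ + 1))) (by positivity)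
  set η := e / (2 * (κ + 1)) with hη
  have hη0 : 0 < η := by positivity
  have hηκ : η * κ ≤ e / 2 := by
    rw [hη, div_mul_eq_mul_div, div_le_div_iff₀ (by positivity) (by norm_num)]; nlinarith
  set Q := C2 * (s^2 + σ^2 * |s|) with hQ
  have hQ0 : 0 ≤ Q := by positivity
  refine ⟨min (δ^2 / (2 * (κ+1))) (e / (2 * (Q+1))), by positivity, fun h hh k x => ?_⟩
  have hh1 : h * (2 * (κ+1)) ≤ δ^2 := (le_div_iff₀ (by positivity)).1 (hh.trans (min_le_left _ _))
  have hh2 : h * (2 * (Q+1)) ≤ e := (le_div_iff₀ (by positivity)).1 (hh.trans (min_le_right _ _))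
  have hb := stepB_ok k
  have hlt : ∀ z : ℝ, z^2 ≤ κ * h → |z| < δ := by
    intro z hz
    refine abs_lt_of_sq_lt_sq (lt_of_le_of_lt hz ?_) hδ.le
    have := k.h0
    nlinarith
  have tu := ht x x.2 _ (stu s σ h x).2 (hlt _ (hb.squ x))
  have td := ht x x.2 _ (std s σ h x).2 (hlt _ (hb.sqd x))
  have tu' := tu.trans (mul_le_mul_of_nonneg_left (hb.squ x) hη0.le)
  have td' := td.trans (mul_le_mul_of_nonneg_left (hb.sqd x) hη0.le)
  have hc := hC2 x x.2
  have hm := stm_mem k x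
  have hx := x.2
  rw [stp_coe k]
  have hsq : √h ^ 2 = h := Real.sq_sqrt k.h0.le
  have hcu := stu_coe k x
  have hcd := std_coe k x
  generalize ((stu s σ h x : UI) : ℝ) = U at *
  generalize ((std s σ h x : UI) : ℝ) = D at *
  set m := stm s h x with hmdef
  have hmx : m - x = - (s * h * ((x:ℝ) * (1-x))) := by simp only [hmdef, stm]; ring
  set A := f U - f x - deriv f x * (U - x) - deriv (deriv f) x / 2 * (U - x)^2 with hA
  set B := f D - f x - deriv f x * (D - x) - deriv (deriv f) x / 2 * (D - x)^2 with hB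
  set y : ℝ := (x:ℝ) * (1-x) with hy
  have hy0 : 0 ≤ y := mul_nonneg hx.1 (by linarith [hx.2])
  have hy1 : y ≤ 1 := by nlinarith [hx.1, hx.2]
  have e1 : m * f U + (1 - m) * f D - f x - h * LWF s σ f x = m * A + (1 - m) * B
      + deriv (deriv f) x / 2 * ((m-x)^2 + σ^2 * h * (m * (1-m) - y)) := by
    have q1 : m * (U - x) + (1-m) * (D - x) = -(s*h*y) := by rw [hcu, hcd, ← hmx]; ring
    have q2 : m * (U - x)^2 + (1-m) * (D - x)^2 = (m-x)^2 + σ^2 * h * (m * (1-m)) := by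
      rw [hcu, hcd]; linear_combination (σ^2 * (m * (1-m))) * hsq
    simp only [hA, hB, LWF]
    linear_combination deriv f x * q1 + deriv (deriv f) x / 2 * q2
  have e2 : |m * A + (1 - m) * B| ≤ η * (κ * h) := by
    have z1 : |m * A| ≤ m * (η * (κ*h)) := by
      rw [abs_mul, abs_of_nonneg hm.1]; exact mul_le_mul_of_nonneg_left tu' hm.1
    have z2 : |(1-m) * B| ≤ (1-m) * (η * (κ*h)) := by
      have : 0 ≤ 1 - m := by linarith [hm.2]
      rw [abs_mul, abs_of_nonneg this]; exact mul_le_mul_of_nonneg_left td' this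
    refine (abs_add_le _ _).trans ((add_le_add z1 z2).trans (le_of_eq (by ring)))
  have hs0 := k.s0
  have hh0 := k.h0
  have w1 : |m - x| ≤ s * h := by
    rw [hmx, abs_neg, abs_of_nonneg (by positivity)]
    exact mul_le_of_le_one_right (by positivity) hy1
  have w2 : |m * (1-m) - y| ≤ s * h := by
    have : m * (1-m) - y = (m - x) * (1 - m - x) := by rw [hy]; ring
    rw [this, abs_mul]
    have : |1 - m - (x:ℝ)| ≤ 1 := abs_le.2 ⟨by linarith [hm.2, hx.2], by linarith [hm.1, hx.1]⟩
    exact (mul_le_mul w1 this (abs_nonneg _) (by positivity)).trans (by rw [mul_one])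
  have w3 : |(m-x)^2 + σ^2 * h * (m * (1-m) - y)| ≤ (s*h)^2 + σ^2 * h * (s * h) := by
    refine (abs_add_le _ _).trans (add_le_add ?_ ?_)
    · rw [abs_pow]; gcongr
    · rw [abs_mul, abs_of_nonneg (show 0 ≤ σ^2 * h by positivity)]; gcongr
  have e3 : |deriv (deriv f) x / 2 * ((m-x)^2 + σ^2 * h * (m * (1-m) - y))| ≤ Q * h * h := by
    rw [abs_mul]
    have : |deriv (deriv f) x / 2| ≤ C2 := by
      rw [abs_div]; norm_num; linarith [abs_nonneg (deriv (deriv f) x)]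
    refine (mul_le_mul this w3 (abs_nonneg _) hC20).trans (le_of_eq ?_)
    rw [hQ, abs_of_nonneg hs0]; ring
  rw [e1]
  refine (abs_add_le _ _).trans ((add_le_add e2 e3).trans ?_)
  have f0 : h * (2 * (Q+1)) = 2 * (Q * h) + 2 * h := by ring
  have f1 : Q * h ≤ e / 2 := by linarith
  have f2 := mul_le_mul_of_nonneg_right f1 hh0.le
  have f3 := mul_le_mul_of_nonneg_right hηκ hh0.le
  have f4 : η * (κ * h) = η * κ * h := by ring
  have f5 : e / 2 * h + e / 2 * h = h * e := by ring
  linarith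
end

section

section lim

def kk (M : ℕ → ℕ) (N : ℕ) (q : ℚ) : ℕ := ⌊(q:ℝ) * (M N : ℝ)⌋₊

lemma kk_mono (M : ℕ → ℕ) (N : ℕ) {p q : ℚ} (h : p ≤ q) : kk M N p ≤ kk M N q := by
  unfold kk
  have : (p:ℝ) ≤ q := by exact_mod_cast h
  exact Nat.floor_le_floor (by gcongr)

lemma kk_conv {M : ℕ → ℕ} (hM : Tendsto M atTop atTop) (q : ℚ) (hq : 0 ≤ q) :
    Tendsto (fun N : ℕ => (kk M N q : ℝ) * (1 / (M N : ℝ))) atTop (𝓝 (q:ℝ)) := by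
  have h := tendsto_nat_floor_mul_div_atTop (R := ℝ) (a := (q:ℝ)) (by exact_mod_cast hq)
  have h2 : Tendsto (fun N : ℕ => (M N:ℝ)) atTop atTop := tendsto_natCast_atTop_atTop.comp hM
  refine (h.comp h2).congr fun N => ?_
  simp only [Function.comp, kk]
  rw [div_eq_mul_one_div]

def thN (M : ℕ → ℕ) (N : ℕ) (w : ℕ → UI) : ℚ → UI := fun q => w (kk M N q)

lemma thN_meas (M : ℕ → ℕ) (N : ℕ) : Measurable (thN M N) :=
  measurable_pi_lambda _ fun _ => measurable_pi_apply _

lemma lim_exists (M : ℕ → ℕ) (μ : ℕ → Measure (ℕ → UI)) (hμ : ∀ N, IsProbabilityMeasure (μ N)) :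
    ∃ ν : Measure (ℚ → UI), IsProbabilityMeasure ν ∧ ∀ Φ : (ℚ → UI) → ℝ, Continuous Φ →
      Tendsto (fun N => ∫ w, Φ (thN M N w) ∂(μ N)) (hyperfilter ℕ : Filter ℕ) (𝓝 (∫ y, Φ y ∂ν)) := by
  let ν : ℕ → ProbabilityMeasure (ℚ → UI) := fun N =>
    ⟨(μ N).map (thN M N), Measure.isProbabilityMeasure_map (thN_meas M N).aemeasurable⟩
  obtain ⟨ν0, -, h⟩ := (isCompact_univ (X := ProbabilityMeasure (ℚ → UI))).ultrafilter_le_nhds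
    ((hyperfilter ℕ).map ν) (by simp)
  have h' : Tendsto ν (hyperfilter ℕ : Filter ℕ) (𝓝 ν0) := h
  rw [ProbabilityMeasure.tendsto_iff_forall_integral_tendsto] at h'
  refine ⟨ν0, inferInstance, fun Φ hΦ => ?_⟩
  have := h' (BoundedContinuousFunction.mkOfCompact ⟨Φ, hΦ⟩)
  refine this.congr fun N => ?_
  change ∫ y, Φ y ∂((μ N).map (thN M N)) = _
  rw [integral_map (thN_meas M N).aemeasurable hΦ.measurable.aestronglyMeasurable]

lemma core_from_chain {s σ : ℝ} (hs : 0 ≤ s) (hσ : 0 < σ) (α : Measure ℝ) [IsProbabilityMeasure α]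
    (hα : α (Icc (0:ℝ) 1)ᶜ = 0) : Nonempty (WFCore s σ α) := by
  obtain ⟨N0, hN0⟩ := exists_nat_ge (max s (σ^2))
  set M : ℕ → ℕ := fun N => N + N0 + 1 with hMdef
  have hMt : Tendsto M atTop atTop := tendsto_atTop_mono (fun n => by simp only [hMdef, id]; omega) tendsto_id
  have hM1 : ∀ N, (N0:ℝ) + 1 ≤ (M N : ℝ) := fun N => by
    simp only [hMdef]; push_cast; linarith [Nat.cast_nonneg (α := ℝ) N]
  have hMpos : ∀ N, (0:ℝ) < M N := fun N => by
    have := hM1 N; linarith [Nat.cast_nonneg (α := ℝ) N0]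
  set hh : ℕ → ℝ := fun N => 1 / (M N : ℝ) with hhdef
  have hok : ∀ N, HOK s σ (hh N) := by
    intro N
    have h1 := hM1 N
    have hp := hMpos N
    have hN0' : (0:ℝ) ≤ N0 := Nat.cast_nonneg _
    have hss := (le_max_left s (σ^2)).trans hN0
    have hσσ := (le_max_right s (σ^2)).trans hN0
    refine ⟨hs, hσ, by positivity, ?_, ?_, ?_⟩
    · rw [hhdef]; simp only; rw [div_le_one hp]; linarith
    · simp only [hhdef]; rw [mul_one_div, div_le_one hp]; linarith
    · refine abs_le_one_iff_mul_self_le_one.2 ?_ |> le_of_abs_le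
      have : σ * √(hh N) * (σ * √(hh N)) = σ^2 * (√(hh N) * √(hh N)) := by ring
      rw [this, Real.mul_self_sqrt (by positivity)]
      simp only [hhdef]; rw [mul_one_div, div_le_one hp]; linarith
  have mpr : Measurable (projIcc (0:ℝ) 1 zero_le_one) := continuous_projIcc.measurable
  set α' : Measure UI := α.map (projIcc (0:ℝ) 1 zero_le_one) with hα'
  have pα' : IsProbabilityMeasure α' := Measure.isProbabilityMeasure_map mpr.aemeasurable
  have hch : ∀ N, ∃ μ, IsWFChain (stp s (hh N)) (stu s σ (hh N)) (std s σ (hh N)) α' (M N * M N) μ := fun N =>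
    chain_exists (stepB_ok (hok N)).mp (stepB_ok (hok N)).mu (stepB_ok (hok N)).md α' _
  choose μ hμ using hch
  have hμp : ∀ N, IsProbabilityMeasure (μ N) := fun N => (hμ N).prob
  obtain ⟨ν, hν, hlim⟩ := lim_exists M μ hμp
  have hyp : (hyperfilter ℕ : Filter ℕ) ≤ atTop := Nat.hyperfilter_le_atTop
  have cval : ∀ q : ℚ, Continuous (fun y : ℚ → UI => ((y q : UI) : ℝ)) := fun q =>
    continuous_subtype_val.comp (continuous_apply q)
  have tj : ∀ p q : ℚ, 0 ≤ p → p ≤ q → Tendsto (fun N => (((kk M N q - kk M N p : ℕ) : ℝ) * hh N))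
      (hyperfilter ℕ : Filter ℕ) (𝓝 ((q - p : ℚ):ℝ)) := by
    intro p q hp hpq
    have := ((kk_conv hMt q (hp.trans hpq)).sub (kk_conv hMt p hp)).mono_left hyp
    push_cast
    refine this.congr fun N => ?_
    rw [Nat.cast_sub (kk_mono M N hpq)]; ring
  have hor : ∀ q : ℚ, ∀ᶠ N in (hyperfilter ℕ : Filter ℕ), kk M N q ≤ M N * M N := by
    intro q
    obtain ⟨Q, hQ⟩ := exists_nat_ge (q:ℝ)
    have : ∀ᶠ N in atTop, Q ≤ M N := hMt.eventually_ge_atTop Q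
    refine hyp ?_
    filter_upwards [this] with N hN
    unfold kk
    refine Nat.floor_le_of_le ?_
    push_cast
    have : (Q:ℝ) ≤ M N := by exact_mod_cast hN
    have := hMpos N
    gcongr; linarith
  set κ := (s+σ)^2 with hκ
  refine core_exists (P := ν) (Y := fun q y => ((y q : UI) : ℝ)) (fun q => (cval q).measurable) (fun q y => (y q).2) ?_
    ((4*s+8*κ)*(2*s+κ) + 3*κ^2) ?_ ?_
  · have e0 : ν.map (fun y => y 0) = α' := by
      have : IsProbabilityMeasure (ν.map (fun y : ℚ → UI => y 0)) :=
        Measure.isProbabilityMeasure_map (measurable_pi_apply 0).aemeasurable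
      refine ext_of_forall_integral_eq_of_IsFiniteMeasure fun g => ?_
      rw [integral_map (measurable_pi_apply 0).aemeasurable g.continuous.measurable.aestronglyMeasurable]
      refine tendsto_nhds_unique (hlim (fun y => g (y 0)) (g.continuous.comp (continuous_apply 0))) ?_
      have : ∀ N, ∫ w, g (thN M N w 0) ∂(μ N) = ∫ x, g x ∂α' := by
        intro N
        rw [← (hμ N).init, integral_map (measurable_pi_apply 0).aemeasurable g.continuous.measurable.aestronglyMeasurable]
        simp [thN, kk]
      simp_rw [this]
      exact tendsto_const_nhds
    have : (fun y : ℚ → UI => ((y 0 : UI) : ℝ)) = Subtype.val ∘ (fun y : ℚ → UI => y 0) := rfl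
    rw [this, ← Measure.map_map measurable_subtype_coe (measurable_pi_apply 0), e0, hα',
      Measure.map_map measurable_subtype_coe mpr]
    have hae : (Subtype.val ∘ projIcc (0:ℝ) 1 zero_le_one) =ᵐ[α] id := by
      have : ∀ᵐ x ∂α, x ∈ Icc (0:ℝ) 1 := by rw [ae_iff]; exact hα
      filter_upwards [this] with x hx
      simp only [Function.comp, id]; rw [projIcc_of_mem _ hx]
    rw [Measure.map_congr hae, Measure.map_id]
  · intro p q hp hpq
    have t1 := hlim (fun y => ((y q : ℝ) - y p)^4) (((cval q).sub (cval p)).pow 4)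
    have t2 := ((tj p q hp hpq).pow 2).const_mul ((4*s+8*κ)*(2*s+κ) + 3*κ^2)
    refine le_of_tendsto_of_tendsto t1 t2 ?_
    filter_upwards [hor q] with N hN
    have hJ := kk_mono M N hpq
    have := mom4 (stepB_ok (hok N)) (hμ N) (kk M N p) (kk M N q - kk M N p) (by omega)
    rw [Nat.add_sub_cancel' hJ, mul_comm (hh N)] at this
    exact this
  · intro f hf η hη
    have hLc := LWF_cont s σ f hf
    obtain ⟨Ce, hCe0, hCe⟩ := mod01 _ hLc (η/3) (by positivity)
    obtain ⟨h0, hh0, hgen⟩ := gen_conv s σ f hf (η/3) (by positivity)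
    have hκ0 : 0 ≤ κ := sq_nonneg _
    refine ⟨η / (3 * (Ce * (2*s+κ) + 1)), by positivity, fun p q hp hpq hd ι _ u hu g => ?_⟩
    have cG : Continuous (fun y : ℚ → UI => g (fun i => ((y (u i) : UI) : ℝ))) :=
      g.continuous.comp (continuous_pi fun i => cval _)
    have cf : ∀ q : ℚ, Continuous (fun y : ℚ → UI => f (y q)) := fun q => hf.continuous.comp (cval q)
    have cL : ∀ q : ℚ, Continuous (fun y : ℚ → UI => LWF s σ f (y q)) := fun q => hLc.comp (cval q)
    have c1 : Continuous (fun y : ℚ → UI => g (fun i => ((y (u i) : UI) : ℝ)) * (f (y q) - f (y p))) :=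
      cG.mul ((cf q).sub (cf p))
    have c2 : Continuous (fun y : ℚ → UI => g (fun i => ((y (u i) : UI) : ℝ)) * LWF s σ f (y p)) := cG.mul (cL p)
    have icont : ∀ {ρ : Measure (ℚ → UI)} [IsProbabilityMeasure ρ] {Φ : (ℚ → UI) → ℝ}, Continuous Φ → Integrable Φ ρ := by
      intro ρ _ Φ hΦ
      exact (BoundedContinuousFunction.mkOfCompact ⟨Φ, hΦ⟩).integrable ρ
    have imu : ∀ {Φ : (ℚ → UI) → ℝ} (N : ℕ), Continuous Φ → Integrable (fun w => Φ (thN M N w)) (μ N) := by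
      intro Φ N hΦ
      exact int_bdd (hΦ.measurable.comp (thN_meas M N)) ‖BoundedContinuousFunction.mkOfCompact ⟨Φ, hΦ⟩‖
        (fun w => (BoundedContinuousFunction.mkOfCompact ⟨Φ, hΦ⟩).norm_coe_le_norm _)
    have t1 := hlim _ c1
    have t2 := hlim _ c2
    have tt := t1.sub ((tj p q hp hpq).mul t2)
    have eL : ∫ y : ℚ → UI, g (fun i => ((y (u i) : UI) : ℝ)) * (f (y q) - f (y p) - ((q - p : ℚ):ℝ) * LWF s σ f (y p)) ∂ν
        = ∫ y : ℚ → UI, g (fun i => ((y (u i) : UI) : ℝ)) * (f (y q) - f (y p)) ∂ν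
          - ((q - p : ℚ):ℝ) * ∫ y : ℚ → UI, g (fun i => ((y (u i) : UI) : ℝ)) * LWF s σ f (y p) ∂ν := by
      rw [← integral_const_mul, ← integral_sub (icont c1) ((icont c2).const_mul _)]
      refine integral_congr_ae (ae_of_all _ fun y => ?_)
      simp only; ring
    rw [eL]
    have hlimb := ((tj p q hp hpq).const_mul ‖g‖).mul
      (((tj p q hp hpq).const_mul (2*s+κ)).const_mul Ce |>.const_add (η/3 + η/3))
    have hfin : |∫ y : ℚ → UI, g (fun i => ((y (u i) : UI) : ℝ)) * (f (y q) - f (y p)) ∂ν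
          - ((q - p : ℚ):ℝ) * ∫ y : ℚ → UI, g (fun i => ((y (u i) : UI) : ℝ)) * LWF s σ f (y p) ∂ν|
        ≤ ‖g‖ * ((q - p : ℚ):ℝ) * (η/3 + η/3 + Ce * ((2*s+κ) * ((q - p : ℚ):ℝ))) := by
      refine le_of_tendsto_of_tendsto tt.abs hlimb ?_
      have hsm : ∀ᶠ N in (hyperfilter ℕ : Filter ℕ), hh N ≤ h0 := by
        refine hyp ?_
        have : Tendsto hh atTop (𝓝 0) := by
          simp only [hhdef]
          exact tendsto_const_nhds.div_atTop (tendsto_natCast_atTop_atTop.comp hMt)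
        exact (this.eventually (gt_mem_nhds hh0)).mono fun N h => le_of_lt h
      filter_upwards [hor q, hsm] with N hN hN2
      have hJ := kk_mono M N hpq
      have key := gen_est (stepB_ok (hok N)) (hμ N) f (LWF s σ f) hf.continuous hLc (η/3) (η/3) Ce (by positivity)
        (by positivity) hCe0 (hgen (hh N) hN2 (hok N)) hCe (kk M N p) (fun w => g (fun i => ((thN M N w (u i) : UI) : ℝ)))
        (cG.measurable.comp (thN_meas M N)) ‖g‖ (norm_nonneg _) (fun w => g.norm_coe_le_norm _)
        (fun w w' hw => by
          simp only [thN]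
          congr 1; ext i; rw [hw _ (kk_mono M N (hu i).2)])
        (kk M N q - kk M N p) (by omega)
      rw [Nat.add_sub_cancel' hJ, mul_comm (hh N)] at key
      refine le_trans (le_of_eq ?_) key
      congr 1
      rw [← integral_const_mul, ← integral_sub (imu N c1) ((imu N c2).const_mul _)]
      refine integral_congr_ae (ae_of_all _ fun y => ?_)
      simp only [thN]; ring
    refine hfin.trans ?_
    have hD0 : (0:ℝ) ≤ ((q - p : ℚ):ℝ) := by exact_mod_cast sub_nonneg.2 hpq
    have hb : Ce * ((2*s+κ) * ((q - p : ℚ):ℝ)) ≤ η/3 := by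
      rw [lt_div_iff₀ (by positivity)] at hd
      nlinarith
    calc _ ≤ ‖g‖ * ((q - p : ℚ):ℝ) * (η/3 + η/3 + η/3) := by gcongr
      _ = _ := by ring
end lim
end

end WFHelpers

/-- For fixed `σ > 0`, `s ≥ 0` and any bounded measurable group-level
selection profile `r⁰`, there is a critical value `R_∧ > 0` such that for every
`0 < R < R_∧`, the killed system with (normalized) killing rate
`r = R (r⁰ - sup r⁰) ≤ 0` satisfies `ρ_0 ∧ ρ_1 < ρ_α`: when group selection is too
weak, the QSD on `(0,1)` decays strictly faster than at least one of the absorbing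
boundaries, so polymorphic groups cannot be maintained. -/
theorem wf_weak_group_selection_fixation
    (s σ : ℝ) (hs : 0 ≤ s) (hσ : 0 < σ)
    (r0 : ℝ → ℝ) (hr0meas : Measurable r0) (hr0Bdd : ∃ M, ∀ x, |r0 x| ≤ M) :
    ∃ Rc : ℝ, 0 < Rc ∧ ∀ R : ℝ, 0 < R → R < Rc →
      ∀ (α : Measure ℝ) (ρα : ℝ),
        IsQSD s σ (fun x => R * (r0 x - sSup (r0 '' Icc (0:ℝ) 1))) α ρα →
        min (-(R * (r0 0 - sSup (r0 '' Icc (0:ℝ) 1))))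
            (-(R * (r0 1 - sSup (r0 '' Icc (0:ℝ) 1)))) < ρα := by
  obtain ⟨M, hM⟩ := hr0Bdd
  refine ⟨σ^2 / (2*|M|+1), by positivity, fun R hR hRc α ρα h => ?_⟩
  have hα := h.1
  have hsub : (Icc (0:ℝ) 1)ᶜ ⊆ (Ioo (0:ℝ) 1)ᶜ := compl_subset_compl.2 Ioo_subset_Icc_self
  obtain ⟨K⟩ := core_from_chain hs hσ α (measure_mono_null hsub h.2.1)
  obtain ⟨W⟩ := core_to_killed (fun x => R * (r0 x - sSup (r0 '' Icc (0:ℝ) 1))) K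
  have h1 := rate_lower s σ hσ _ α ρα h W
  refine lt_of_le_of_lt (min_le_left _ _) (lt_of_lt_of_le ?_ h1)
  have h2 : sSup (r0 '' Icc (0:ℝ) 1) ≤ |M| := by
    refine csSup_le ((nonempty_Icc.2 zero_le_one).image r0) ?_
    rintro _ ⟨x, -, rfl⟩
    exact (le_abs_self _).trans ((hM x).trans (le_abs_self M))
  have h3 : -|M| ≤ r0 0 := by
    have := (abs_le.1 (hM 0)).1
    linarith [le_abs_self M]
  rw [lt_div_iff₀ (by positivity)] at hRc
  nlinarith

end
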